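/- Let ε > 0 and let w be a smooth non-negative function on ℝ supported on the interval (1,2) with bounded derivatives. There exists a constant C = C(ε, w) such that for every real K ≥ 2 and all positive integers α, β, γ, r₁, r₂ with K^{−ε} < r₁/r₂ < K^{ε}, the quantity ℰ₁ = (1/(2π²K)) ∑_{k ≥ 2 even} w(k/K) ((k−1)/K) ∑_{m ≥ 1} ∑_{c₁ ≥ 1} ( S(r₁αβ², m; c₁) / ((m r₁)^{1/2} c₁) ) J_{2k−1}(4π√(r₁ m α β²)/c₁) V_{k,1}(m) V_{k,2}(r₁ r₂² α³ β² γ²) satisfies |ℰ₁| ≤ C K^{−1/4+ε}. -/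

import Mathlib

noncomputable section

/-- e(x) = exp(2πi x) -/
def ee (x : ℝ) : ℂ := Complex.exp (2 * Real.pi * Complex.I * x)

/-- Bessel function of integer order: J_ℓ(x) = ∫_{-1/2}^{1/2} e(ℓt) e^{-ix sin(2πt)} dt -/
def besselJ (ℓ : ℕ) (x : ℝ) : ℂ :=
  ∫ t in (-(1:ℝ)/2)..(1/2), ee (ℓ * t) * Complex.exp (-Complex.I * x * Real.sin (2 * Real.pi * t))

/-- Kloosterman sum S(n,m;c) -/
def kloos (n m : ℤ) (c : ℕ) : ℂ :=
  ∑ b ∈ Finset.range c, if Nat.Coprime b c then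
    ee (((((n : ZMod c) * (b : ZMod c) + (m : ZMod c) * (b : ZMod c)⁻¹).val : ℕ) : ℝ) / c)
  else 0

/-- Λ_{k,j}(s) -/
def Lam (j : ℕ) (k : ℝ) (s : ℂ) : ℂ :=
  if j = 1 then (2 * Real.pi : ℂ) ^ (-s) * Complex.Gamma (s + (k : ℂ) - 1/2)
  else 8 * (2 * Real.pi : ℂ) ^ (-3*s - 3*(k:ℂ) + 3/2) * Complex.Gamma (s + 2*(k:ℂ) - 3/2) *
    Complex.Gamma (s + (k:ℂ) - 1/2) * Complex.Gamma (s + 1/2)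

/-- V_{k,j}(ξ), contour integral on Re s = 1 -/
def V (j : ℕ) (k : ℝ) (ξ : ℝ) : ℂ :=
  (1 / (2 * Real.pi * Complex.I)) * ∫ t : ℝ,
    (Lam j k (1/2 + (1 + (t:ℂ) * Complex.I)) / Lam j k (1/2)) *
      (ξ : ℂ) ^ (-(1 + (t:ℂ) * Complex.I)) / (1 + (t:ℂ) * Complex.I) * Complex.I

/-- Fourier transform ĥ(t) = ∫ h(v) e(−vt) dv -/
def fhat (h : ℝ → ℂ) (t : ℝ) : ℂ := ∫ v : ℝ, h v * ee (-(v * t))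

end

section

open MeasureTheory

lemma ee_norm (x : ℝ) : ‖ee x‖ = 1 := by
  have : ee x = Complex.exp ((2 * Real.pi * x : ℝ) * Complex.I) := by
    unfold ee; congr 1; push_cast; ring
  rw [this, Complex.norm_exp_ofReal_mul_I]

lemma ee_add (x y : ℝ) : ee (x + y) = ee x * ee y := by
  unfold ee; rw [← Complex.exp_add]; congr 1; push_cast; ring

lemma ee_nat (n : ℕ) : ee (n:ℝ) = 1 := by
  unfold ee
  rw [Complex.exp_eq_one_iff]; exact ⟨n, by push_cast; ring⟩

lemma ee_nat_mul (n : ℕ) (x : ℝ) : ee (n * x) = ee x ^ n := by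
  unfold ee; rw [← Complex.exp_nat_mul]; congr 1; push_cast; ring

lemma ee_cont : Continuous ee := by unfold ee; fun_prop

lemma phase_norm (x t : ℝ) :
    ‖Complex.exp (-Complex.I * x * Real.sin (2 * Real.pi * t))‖ = 1 := by
  have : -Complex.I * x * Real.sin (2 * Real.pi * t)
      = ((-x * Real.sin (2 * Real.pi * t) : ℝ) : ℂ) * Complex.I := by push_cast; ring
  rw [this, Complex.norm_exp_ofReal_mul_I]

lemma bessel_cont (f : ℝ → ℂ) (hf : Continuous f) (x : ℝ) :
    Continuous fun t : ℝ => f t * Complex.exp (-Complex.I * x * Real.sin (2 * Real.pi * t)) := by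
  fun_prop

lemma besselJ_norm_le (ℓ : ℕ) (x : ℝ) : ‖besselJ ℓ x‖ ≤ 1 := by
  unfold besselJ
  have := intervalIntegral.norm_integral_le_of_norm_le_const (a := (-(1:ℝ)/2)) (b := 1/2) (C := 1)
    (f := fun t : ℝ => ee (ℓ * t) * Complex.exp (-Complex.I * x * Real.sin (2 * Real.pi * t)))
    (by intro t _; rw [norm_mul, ee_norm, phase_norm]; norm_num)
  refine this.trans (by norm_num)

lemma besselJ_rec (ℓ : ℕ) (x : ℝ) :
    2 * ((ℓ : ℂ) + 1) * besselJ (ℓ + 1) x = x * (besselJ ℓ x + besselJ (ℓ + 2) x) := by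
  have key : ∫ t in (-(1:ℝ)/2)..(1/2), (2 * Real.pi * Complex.I) *
      (((ℓ : ℂ) + 1) * (ee ((ℓ + 1 : ℕ) * t) * Complex.exp (-Complex.I * x * Real.sin (2 * Real.pi * t)))
       - x / 2 * (ee (ℓ * t) * Complex.exp (-Complex.I * x * Real.sin (2 * Real.pi * t))
          + ee ((ℓ + 2 : ℕ) * t) * Complex.exp (-Complex.I * x * Real.sin (2 * Real.pi * t)))) = 0 := by
    have hd : ∀ t ∈ Set.uIcc (-(1:ℝ)/2) (1/2), HasDerivAt (fun t : ℝ => ee ((ℓ + 1 : ℕ) * t) *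
        Complex.exp (-Complex.I * x * Real.sin (2 * Real.pi * t)))
        ((2 * Real.pi * Complex.I) *
      (((ℓ : ℂ) + 1) * (ee ((ℓ + 1 : ℕ) * t) * Complex.exp (-Complex.I * x * Real.sin (2 * Real.pi * t)))
       - x / 2 * (ee (ℓ * t) * Complex.exp (-Complex.I * x * Real.sin (2 * Real.pi * t))
          + ee ((ℓ + 2 : ℕ) * t) * Complex.exp (-Complex.I * x * Real.sin (2 * Real.pi * t))))) t := by
      intro t _
      have h1 : HasDerivAt (fun t : ℝ => ee ((ℓ + 1 : ℕ) * t))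
          (ee ((ℓ + 1 : ℕ) * t) * (2 * Real.pi * Complex.I * (ℓ + 1))) t := by
        unfold ee
        have : HasDerivAt (fun t : ℝ => (2 * Real.pi * Complex.I * (((ℓ + 1 : ℕ) * t : ℝ) : ℂ)))
            (2 * Real.pi * Complex.I * (ℓ + 1)) t := by
          have h0 : HasDerivAt (fun t : ℝ => (((ℓ + 1 : ℕ) * t : ℝ))) ((ℓ + 1 : ℕ) : ℝ) t := by
            simpa using (hasDerivAt_id t).const_mul ((ℓ + 1 : ℕ) : ℝ)
          have := h0.ofReal_comp.const_mul (2 * Real.pi * Complex.I)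
          push_cast at this ⊢
          exact this
        exact this.cexp
      have h2 : HasDerivAt (fun t : ℝ => Complex.exp (-Complex.I * x * Real.sin (2 * Real.pi * t)))
          (Complex.exp (-Complex.I * x * Real.sin (2 * Real.pi * t)) *
            (-Complex.I * x * (Real.cos (2 * Real.pi * t) * (2 * Real.pi)))) t := by
        have h0 : HasDerivAt (fun t : ℝ => Real.sin (2 * Real.pi * t))
            (Real.cos (2 * Real.pi * t) * (2 * Real.pi)) t := by
          have := ((hasDerivAt_id t).const_mul (2 * Real.pi)).sin
          simpa using this
        have := h0.ofReal_comp.const_mul (-Complex.I * x)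
        push_cast at this ⊢
        exact this.cexp
      refine (h1.mul h2).congr_deriv ?_
      have hc : ((Real.cos (2 * Real.pi * t) : ℝ) : ℂ) = (ee t + ee (-t)) / 2 := by
        rw [Complex.ofReal_cos, Complex.cos]
        unfold ee
        congr 3 <;> · push_cast; ring
      have e1 : ee ((ℓ + 2 : ℕ) * t) = ee ((ℓ + 1 : ℕ) * t) * ee t := by
        rw [← ee_add]; congr 1; push_cast; ring
      have e2 : ee (ℓ * t) = ee ((ℓ + 1 : ℕ) * t) * ee (-t) := by
        rw [← ee_add]; congr 1; push_cast; ring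
      rw [hc, e1, e2]
      ring
    rw [intervalIntegral.integral_eq_sub_of_hasDerivAt hd]
    · have e1 : ee ((ℓ + 1 : ℕ) * (1/2 : ℝ)) = ee ((ℓ + 1 : ℕ) * (-(1:ℝ)/2)) := by
        have : ((ℓ + 1 : ℕ) : ℝ) * (1/2 : ℝ) = ((ℓ + 1 : ℕ) * (-(1:ℝ)/2)) + (ℓ + 1 : ℕ) := by ring
        rw [this, ee_add, ee_nat, mul_one]
      rw [e1]
      have s1 : Real.sin (2 * Real.pi * (1/2)) = 0 := by
        rw [show 2 * Real.pi * (1/2) = Real.pi by ring]; exact Real.sin_pi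
      have s2 : Real.sin (2 * Real.pi * (-1/2)) = 0 := by
        rw [show 2 * Real.pi * (-1/2) = -Real.pi by ring]; simp
      rw [s1, s2]; simp
    · apply Continuous.intervalIntegrable
      have := ee_cont
      fun_prop
  have hI : ∀ n : ℕ, IntervalIntegrable (fun t : ℝ => ee (n * t) *
      Complex.exp (-Complex.I * x * Real.sin (2 * Real.pi * t))) volume (-(1:ℝ)/2) (1/2) := by
    intro n
    apply Continuous.intervalIntegrable
    have := ee_cont
    fun_prop
  rw [intervalIntegral.integral_const_mul, intervalIntegral.integral_sub, intervalIntegral.integral_const_mul,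
    intervalIntegral.integral_const_mul, intervalIntegral.integral_add (hI _) (hI _)] at key
  · change _ * (_ * besselJ (ℓ+1) x - _ * (besselJ ℓ x + besselJ (ℓ+2) x)) = 0 at key
    have hp : (2 * Real.pi * Complex.I : ℂ) ≠ 0 := by
      simp [Real.pi_ne_zero]
    have := (mul_eq_zero.1 key).resolve_left hp
    linear_combination 2 * this
  · exact (hI _).const_mul _
  · exact ((hI _).add (hI _)).const_mul _

lemma besselJ_small (x : ℝ) (hx : 0 ≤ x) (n : ℕ) : ∀ ℓ : ℕ, n < ℓ →
    ‖besselJ ℓ x‖ ≤ (x / ((ℓ : ℝ) - n)) ^ n := by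
  induction n with
  | zero => intro ℓ _; simpa using besselJ_norm_le ℓ x
  | succ n ih =>
    intro ℓ hℓ
    obtain ⟨p, rfl⟩ : ∃ p, ℓ = p + 1 := ⟨ℓ - 1, by omega⟩
    have hp : n < p := by omega
    have hpn : (0:ℝ) < (p:ℝ) - n := by
      have : (n:ℝ) < p := by exact_mod_cast hp
      linarith
    have h1 := ih p hp
    have h2 := ih (p + 2) (by omega)
    have h2' : ‖besselJ (p+2) x‖ ≤ (x / ((p:ℝ) - n)) ^ n := by
      refine h2.trans ?_
      have : (x / (((p + 2 : ℕ) : ℝ) - n)) ≤ x / ((p:ℝ) - n) := by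
        gcongr
        push_cast; linarith
      have h0 : 0 ≤ (x / (((p + 2 : ℕ) : ℝ) - n)) := by
        apply div_nonneg hx
        push_cast; linarith
      exact pow_le_pow_left₀ h0 this n
    have hr := besselJ_rec p x
    have hr' := congrArg norm hr
    rw [norm_mul, norm_mul (x:ℂ)] at hr'
    have hn1 : ‖(2 * ((p:ℂ) + 1))‖ = 2 * ((p:ℝ) + 1) := by
      have : (2 * ((p:ℂ) + 1)) = ((2 * ((p:ℝ) + 1) : ℝ) : ℂ) := by push_cast; ring
      rw [this, Complex.norm_real, Real.norm_of_nonneg (by positivity)]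
    rw [hn1, Complex.norm_real, Real.norm_of_nonneg hx] at hr'
    have h3 : 2 * ((p:ℝ) + 1) * ‖besselJ (p+1) x‖ ≤ x * (2 * (x / ((p:ℝ) - n)) ^ n) := by
      rw [hr']
      gcongr
      exact (norm_add_le _ _).trans (by linarith)
    have h4 : ‖besselJ (p+1) x‖ ≤ (x / (p + 1)) * (x / ((p:ℝ) - n)) ^ n := by
      rw [div_mul_eq_mul_div, le_div_iff₀ (by positivity)]
      linarith
    refine h4.trans ?_
    have e : (((p + 1 : ℕ) : ℝ) - (n + 1 : ℕ)) = (p:ℝ) - n := by push_cast; ring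
    rw [e, pow_succ, mul_comm]
    gcongr
    have : (0:ℝ) ≤ n := by positivity
    linarith

lemma besselJ_small2 (K x : ℝ) (hK : 2 ≤ K) (hx : 0 ≤ x) (hxK : x ≤ K / 2) (k : ℕ) (hk : K < k) :
    ‖besselJ (2 * k - 1) x‖ ≤ 8 * (x / K) ^ 2 / K := by
  have hk3 : 3 ≤ k := by
    have : (2:ℝ) < k := by linarith
    have : 2 < k := by exact_mod_cast this
    omega
  have h := besselJ_small x hx (k - 1) (2 * k - 1) (by omega)
  refine h.trans ?_
  have e : (((2 * k - 1 : ℕ) : ℝ) - (k - 1 : ℕ)) = k := by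
    rw [Nat.cast_sub (by omega), Nat.cast_sub (by omega)]; push_cast; ring
  rw [e]
  obtain ⟨q, rfl⟩ : ∃ q, k = q + 3 := ⟨k - 3, by omega⟩
  have hK0 : 0 < K := by linarith
  have hxk : x / ((q + 3 : ℕ) : ℝ) ≤ x / K := by gcongr
  have hxk2 : x / ((q + 3 : ℕ) : ℝ) ≤ 1 / 2 := by
    refine hxk.trans ?_
    rw [div_le_div_iff₀ hK0 (by norm_num)]; linarith
  have hnn : 0 ≤ x / ((q + 3 : ℕ) : ℝ) := by positivity
  have h2 : ((q + 3 : ℕ) : ℝ) ≤ 2 ^ (q + 3) := by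
    exact_mod_cast (Nat.lt_two_pow_self (n := q + 3)).le
  calc (x / ((q + 3 : ℕ) : ℝ)) ^ (q + 3 - 1)
      = (x / ((q + 3 : ℕ) : ℝ)) ^ q * (x / ((q + 3 : ℕ) : ℝ)) ^ 2 := by
        rw [← pow_add]; rfl
    _ ≤ (1/2) ^ q * (x / K) ^ 2 := by gcongr
    _ ≤ (8 / K) * (x/K)^2 := by
        gcongr
        rw [le_div_iff₀ hK0]
        have : (1/2:ℝ)^q * K ≤ (1/2:ℝ)^q * 2^(q+3) := by
          gcongr; linarith
        refine this.trans (le_of_eq ?_)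
        rw [pow_add, ← mul_assoc, ← mul_pow]; norm_num
    _ = _ := by ring

end

section
open MeasureTheory

lemma ee_sub_one_ge (u : ℝ) (h0 : 0 ≤ u) (h1 : u ≤ 1) : min u (1 - u) ≤ ‖1 - ee u‖ := by
  have e : ee u = Complex.exp (Complex.I * ((2 * Real.pi * u : ℝ) : ℂ)) := by
    unfold ee; congr 1; push_cast; ring
  rw [norm_sub_rev, e, Complex.norm_exp_I_mul_ofReal_sub_one]
  have hpi := Real.pi_pos
  rw [show 2 * Real.pi * u / 2 = Real.pi * u by ring]
  have hs : 2 * min u (1-u) ≤ Real.sin (Real.pi * u) := by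
    rcases le_total u (1/2) with h | h
    · have := Real.mul_le_sin (x := Real.pi * u) (by positivity) (by nlinarith)
      rw [min_eq_left (by linarith)]
      have e2 : 2 / Real.pi * (Real.pi * u) = 2 * u := by field_simp
      linarith
    · have := Real.mul_le_sin (x := Real.pi * (1 - u)) (mul_nonneg hpi.le (by linarith)) (by nlinarith)
      rw [min_eq_right (by linarith)]
      have e2 : 2 / Real.pi * (Real.pi * (1 - u)) = 2 * (1 - u) := by field_simp
      have e3 : Real.sin (Real.pi * (1 - u)) = Real.sin (Real.pi * u) := by
        rw [mul_sub, mul_one, Real.sin_pi_sub]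
      linarith
  have hm : 0 ≤ min u (1-u) := le_min h0 (by linarith)
  rw [Real.norm_eq_abs]
  refine le_trans ?_ (le_abs_self _)
  linarith

lemma geom_abel (a : ℕ → ℝ) (N : ℕ) (h0 : a 0 = 0) (hN : a N = 0) (z : ℂ) (hz : ‖z‖ = 1) :
    ‖1 - z‖ * ‖∑ j ∈ Finset.range N, (a j : ℂ) * z ^ j‖ ≤ ∑ j ∈ Finset.range N, |a (j+1) - a j| := by
  rw [← norm_mul]
  have e : (1 - z) * ∑ j ∈ Finset.range N, (a j : ℂ) * z ^ j
      = ∑ j ∈ Finset.range N, ((a (j+1) - a j : ℝ) : ℂ) * z ^ (j+1) := by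
    have h1 := Finset.sum_range_succ (fun j => (a j : ℂ) * z ^ j) N
    have h2 := Finset.sum_range_succ' (fun j => (a j : ℂ) * z ^ j) N
    simp only [h0, hN, Complex.ofReal_zero, zero_mul, add_zero] at h1 h2
    have h3 : ∑ j ∈ Finset.range N, ((a (j+1) - a j : ℝ) : ℂ) * z ^ (j+1)
      = ∑ j ∈ Finset.range N, (a (j+1) : ℂ) * z ^ (j+1)
        - z * ∑ j ∈ Finset.range N, (a j : ℂ) * z ^ j := by
      rw [Finset.mul_sum, ← Finset.sum_sub_distrib]
      apply Finset.sum_congr rfl; intro j _; push_cast; ring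
    rw [h3, ← h2, h1]; ring
  rw [e]
  refine (norm_sum_le _ _).trans (Finset.sum_le_sum fun j _ => ?_)
  rw [norm_mul, norm_pow, hz, one_pow, mul_one, Complex.norm_real, Real.norm_eq_abs]

lemma bessel_sum_bound (δ : ℝ) (hδ : 0 < δ) (hδ1 : δ < 1) (a : ℕ → ℝ) (N : ℕ) (h0 : a 0 = 0)
    (hN : a N = 0) (A R : ℝ) (hA : 0 ≤ A) (hR : 0 < R)
    (hvar : ∑ j ∈ Finset.range N, |a (j+1) - a j| ≤ A)
    (habs : ∑ j ∈ Finset.range N, |a j| ≤ A * R) (x : ℝ) :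
    ‖∑ j ∈ Finset.range N, (a j : ℂ) * besselJ (2 * (2 * j) - 1) x‖ ≤ 2 / δ * A * R ^ δ := by
  set G : ℝ → ℂ := fun u => ∑ j ∈ Finset.range N, (a j : ℂ) * ee u ^ j with hG
  have hGc : Continuous G := by
    have := ee_cont
    rw [hG]; fun_prop
  have hGp : Function.Periodic (fun u => ‖G u‖) 1 := by
    intro u
    have : ee (u + 1) = ee u := by
      have h1 := ee_nat 1
      rw [Nat.cast_one] at h1
      rw [ee_add, h1, mul_one]
    simp only [hG, this]
  have e1 : ∑ j ∈ Finset.range N, (a j : ℂ) * besselJ (2 * (2 * j) - 1) x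
      = ∫ t in (-(1:ℝ)/2)..(1/2), ee (-t) * G (4 * t) *
        Complex.exp (-Complex.I * x * Real.sin (2 * Real.pi * t)) := by
    unfold besselJ
    simp_rw [← intervalIntegral.integral_const_mul]
    rw [← intervalIntegral.integral_finsetSum]
    · congr 1; ext t
      rw [hG, Finset.mul_sum, Finset.sum_mul]
      apply Finset.sum_congr rfl
      intro j _
      rcases Nat.eq_zero_or_pos j with rfl | hj
      · simp [h0]
      · have : ee ((2 * (2 * j) - 1 : ℕ) * t) = ee (-t) * ee (4 * t) ^ j := by
          rw [← ee_nat_mul, ← ee_add]; congr 1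
          rw [Nat.cast_sub (by omega)]; push_cast; ring
        rw [this]; ring
    · intro j _
      apply Continuous.intervalIntegrable
      have := ee_cont
      fun_prop
  rw [e1]
  have e2 : ∫ t in (-(1:ℝ)/2)..(1/2), ‖G (4 * t)‖ = ∫ u in (0:ℝ)..1, ‖G u‖ := by
    have := intervalIntegral.integral_comp_mul_left (a := (-(1:ℝ)/2)) (b := 1/2)
      (fun u => ‖G u‖) (c := 4) (by norm_num)
    rw [this]
    have h4 := hGp.intervalIntegral_add_zsmul_eq 4 (4 * (-1/2))
      (fun t₁ t₂ => (hGc.norm.intervalIntegrable t₁ t₂))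
    have h5 : (4 * (-1 / 2) + (4:ℤ) • (1:ℝ)) = 4 * (1/2) := by norm_num
    rw [h5] at h4
    have h6 := hGp.intervalIntegral_add_eq (4 * (-1/2)) 0
    rw [h4, h6, zero_add]; simp
  calc ‖∫ t in (-(1:ℝ)/2)..(1/2), ee (-t) * G (4 * t) *
        Complex.exp (-Complex.I * x * Real.sin (2 * Real.pi * t))‖
      ≤ ∫ t in (-(1:ℝ)/2)..(1/2), ‖ee (-t) * G (4 * t) *
        Complex.exp (-Complex.I * x * Real.sin (2 * Real.pi * t))‖ :=
        intervalIntegral.norm_integral_le_integral_norm (by norm_num)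
    _ = ∫ t in (-(1:ℝ)/2)..(1/2), ‖G (4 * t)‖ := by
        congr 1; ext t; rw [norm_mul, norm_mul, ee_norm, phase_norm, one_mul, mul_one]
    _ = ∫ u in (0:ℝ)..1, ‖G u‖ := e2
    _ ≤ ∫ u in (0:ℝ)..1, (A * R ^ δ) * (u ^ (δ - 1) + (1 - u) ^ (δ - 1)) := by
        apply intervalIntegral.integral_mono_on_of_le_Ioo (by norm_num) (hGc.norm.intervalIntegrable _ _)
        · apply IntervalIntegrable.const_mul
          apply IntervalIntegrable.add
          · exact intervalIntegral.intervalIntegrable_rpow' (by linarith)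
          · have := (intervalIntegral.intervalIntegrable_rpow' (a := 0) (b := 1)
              (r := δ - 1) (by linarith)).comp_sub_left 1
            simp only [sub_zero, sub_self] at this
            exact this.symm
        · intro u hu
          have hz : ‖ee u‖ = 1 := ee_norm u
          have b1 : ‖G u‖ ≤ A * R := by
            refine le_trans ?_ habs
            refine (norm_sum_le _ _).trans (Finset.sum_le_sum fun j _ => ?_)
            rw [norm_mul, norm_pow, hz, one_pow, mul_one, Complex.norm_real, Real.norm_eq_abs]
          have hmin : 0 < min u (1 - u) := lt_min hu.1 (by linarith [hu.2])
          have b2 : ‖G u‖ ≤ A * (min u (1-u))⁻¹ := by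
            have h1 := (geom_abel a N h0 hN (ee u) hz).trans hvar
            have h2 := ee_sub_one_ge u hu.1.le hu.2.le
            rw [← div_eq_mul_inv, le_div_iff₀ hmin]
            calc ‖G u‖ * min u (1-u) ≤ ‖G u‖ * ‖1 - ee u‖ := by gcongr
              _ ≤ A := by rw [mul_comm]; exact h1
          have b3 : ‖G u‖ ≤ A * R ^ δ * (min u (1-u)) ^ (δ - 1) := by
            have hp : ‖G u‖ = ‖G u‖ ^ δ * ‖G u‖ ^ (1 - δ) := by
              rcases eq_or_lt_of_le (norm_nonneg (G u)) with h | h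
              · rw [← h, Real.zero_rpow hδ.ne']; simp
              · rw [← Real.rpow_add h]; simp
            have hpA : A = A ^ δ * A ^ (1 - δ) := by
              rcases eq_or_lt_of_le hA with h | h
              · rw [← h, Real.zero_rpow hδ.ne']; simp
              · rw [← Real.rpow_add h]; simp
            rw [hp]
            calc ‖G u‖ ^ δ * ‖G u‖ ^ (1 - δ) ≤ (A * R) ^ δ * (A * (min u (1-u))⁻¹) ^ (1 - δ) := by
                  gcongr
              _ = (A ^ δ * A ^ (1 - δ)) * R ^ δ * (min u (1-u)) ^ (δ - 1) := by
                  rw [Real.mul_rpow hA hR.le, Real.mul_rpow hA (by positivity),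
                    Real.inv_rpow hmin.le, ← Real.rpow_neg hmin.le]
                  rw [show -(1 - δ) = δ - 1 by ring]; ring
              _ = _ := by rw [← hpA]
          refine b3.trans ?_
          gcongr
          rcases min_choice u (1-u) with h | h
          · rw [h]; have : 0 ≤ (1 - u) ^ (δ - 1) := Real.rpow_nonneg (by linarith [hu.2]) _
            linarith
          · rw [h]; have : 0 ≤ u ^ (δ - 1) := Real.rpow_nonneg hu.1.le _
            linarith
    _ = 2 / δ * A * R ^ δ := by
        have i1 : ∫ u in (0:ℝ)..1, u ^ (δ - 1) = 1 / δ := by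
          rw [integral_rpow (Or.inl (by linarith))]
          rw [sub_add_cancel, Real.one_rpow, Real.zero_rpow hδ.ne', sub_zero]
        have i2 : ∫ u in (0:ℝ)..1, (1 - u) ^ (δ - 1) = 1 / δ := by
          have := intervalIntegral.integral_comp_sub_left (a := 0) (b := 1)
            (fun u : ℝ => u ^ (δ - 1)) 1
          rw [this]; simpa using i1
        rw [intervalIntegral.integral_const_mul, intervalIntegral.integral_add, i1, i2]
        · ring
        · exact intervalIntegral.intervalIntegrable_rpow' (by linarith)
        · have := (intervalIntegral.intervalIntegrable_rpow' (a := 0) (b := 1)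
              (r := δ - 1) (by linarith)).comp_sub_left 1
          simp only [sub_zero, sub_self] at this
          exact this.symm

end

section
open MeasureTheory

noncomputable def kl (c : ℕ) [NeZero c] (n : ℤ) (y : ZMod c) : ℂ :=
  ∑ b : ZMod c, if IsUnit b then (ZMod.stdAddChar ((n : ZMod c) * b + y * b⁻¹) : ℂ) else 0

lemma sum_range_zmod (c : ℕ) [NeZero c] {M : Type*} [AddCommMonoid M] (f : ZMod c → M) :
    ∑ r ∈ Finset.range c, f (r : ZMod c) = ∑ y : ZMod c, f y := by
  refine Finset.sum_nbij' (fun r => (r : ZMod c)) (fun y => y.val) ?_ ?_ ?_ ?_ ?_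
  · intro r _; simp
  · intro y _; simpa using ZMod.val_lt y
  · intro r hr; exact ZMod.val_cast_of_lt (by simpa using hr)
  · intro y _; simp
  · intro r _; rfl

lemma ee_val (c : ℕ) [NeZero c] (y : ZMod c) : ee ((y.val : ℝ) / c) = ZMod.stdAddChar y := by
  rw [ZMod.stdAddChar_apply, ZMod.toCircle_apply]
  unfold ee; congr 1; push_cast; ring

lemma kloos_eq (c : ℕ) [NeZero c] (n m : ℤ) : kloos n m c = kl c n (m : ZMod c) := by
  unfold kl kloos
  rw [← sum_range_zmod]
  apply Finset.sum_congr rfl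
  intro b _
  simp only [ZMod.isUnit_iff_coprime, ee_val]

lemma kl_sq (c : ℕ) [NeZero c] (n : ℤ) : ∑ y : ZMod c, ‖kl c n y‖ ^ 2 ≤ (c:ℝ) ^ 2 := by
  have key : ((∑ y : ZMod c, ‖kl c n y‖ ^ 2 : ℝ) : ℂ)
      = ∑ b : ZMod c, ∑ b' : ZMod c, if IsUnit b ∧ IsUnit b' ∧ b = b' then (c:ℂ) else 0 := by
    push_cast
    have h1 : ∀ y : ZMod c, ((‖kl c n y‖ : ℂ)) ^ 2 = ∑ b : ZMod c, ∑ b' : ZMod c,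
        if IsUnit b ∧ IsUnit b' then
          (ZMod.stdAddChar ((n : ZMod c) * (b - b')) : ℂ) * ZMod.stdAddChar (y * (b⁻¹ - b'⁻¹)) else 0 := by
      intro y
      rw [← Complex.mul_conj']
      unfold kl
      rw [map_sum, Finset.sum_mul_sum]
      apply Finset.sum_congr rfl; intro b _
      apply Finset.sum_congr rfl; intro b' _
      by_cases hb : IsUnit b <;> by_cases hb' : IsUnit b' <;> simp [hb, hb']
      rw [← AddChar.map_neg_eq_conj, ← AddChar.map_add_eq_mul, ← AddChar.map_add_eq_mul]
      congr 1; ring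
    simp_rw [h1]
    rw [Finset.sum_comm]
    apply Finset.sum_congr rfl; intro b _
    rw [Finset.sum_comm]
    apply Finset.sum_congr rfl; intro b' _
    by_cases hb : IsUnit b <;> by_cases hb' : IsUnit b' <;> simp only [hb, hb', true_and, false_and, and_false, if_true, if_false, Finset.sum_const_zero]
    rw [← Finset.mul_sum, AddChar.sum_mulShift _ (ZMod.isPrimitive_stdAddChar c)]
    by_cases hbb : b = b'
    · simp [hbb]
    · have : b⁻¹ - b'⁻¹ ≠ 0 := by
        intro h
        apply hbb
        have h2 : b⁻¹ = b'⁻¹ := sub_eq_zero.1 h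
        have e1 : b * b⁻¹ = 1 := ZMod.mul_inv_of_unit b hb
        have e2 : b' * b'⁻¹ = 1 := ZMod.mul_inv_of_unit b' hb'
        calc b = b * (b' * b'⁻¹) := by rw [e2, mul_one]
          _ = b' * (b * b⁻¹) := by rw [h2]; ring
          _ = b' := by rw [e1, mul_one]
      simp [this, hbb]
  have h2 : (∑ y : ZMod c, ‖kl c n y‖ ^ 2 : ℝ) ≤ ‖((∑ y : ZMod c, ‖kl c n y‖ ^ 2 : ℝ) : ℂ)‖ := by
    rw [Complex.norm_real]; exact le_abs_self _
  refine h2.trans ?_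
  rw [key]
  calc _ ≤ ∑ b : ZMod c, ∑ b' : ZMod c, if b = b' then (c:ℝ) else 0 := by
        refine (norm_sum_le _ _).trans ?_
        apply Finset.sum_le_sum; intro b _
        refine (norm_sum_le _ _).trans ?_
        apply Finset.sum_le_sum; intro b' _
        by_cases hbb : b = b'
        · simp only [hbb, and_true, if_true]; split_ifs <;> simp
        · simp [hbb]
    _ = (c:ℝ)^2 := by simp [ZMod.card]; ring

lemma kloos_block (c : ℕ) (hc : 0 < c) (n : ℤ) (q : ℕ) :
    ∑ r ∈ Finset.range c, ‖kloos n ((q * c + r : ℕ) : ℤ) c‖ ^ 2 ≤ (c:ℝ) ^ 2 := by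
  have : NeZero c := ⟨hc.ne'⟩
  have : ∀ r : ℕ, kloos n ((q * c + r : ℕ) : ℤ) c = kl c n (r : ZMod c) := by
    intro r; rw [kloos_eq]; congr 1; push_cast; simp
  simp_rw [this]
  rw [sum_range_zmod c (fun y => ‖kl c n y‖ ^ 2)]
  exact kl_sq c n

lemma sum_inv_sq (a : ℝ) (ha : 0 < a) (Q : ℕ) :
    ∑ q ∈ Finset.range (Q+1), (1 / (1 + q * a)) ^ 2 ≤ 1 + 1 / a - 1 / a * (1 / (1 + Q * a)) := by
  induction Q with
  | zero => simp
  | succ Q ih =>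
    rw [Finset.sum_range_succ]
    have h : (1 / (1 + ((Q+1 : ℕ):ℝ) * a)) ^ 2 ≤ 1 / a * (1 / (1 + Q * a)) - 1 / a * (1 / (1 + ((Q+1:ℕ):ℝ) * a)) := by
      have e : 1 / a * (1 / (1 + Q * a)) - 1 / a * (1 / (1 + ((Q+1:ℕ):ℝ) * a))
        = 1 / (1 + Q * a) * (1 / (1 + ((Q+1:ℕ):ℝ) * a)) := by
        push_cast
        have : (1 + (Q:ℝ) * a) ≠ 0 := by positivity
        have : (1 + ((Q:ℝ)+1) * a) ≠ 0 := by positivity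
        field_simp; ring
      rw [e, sq]
      gcongr
      push_cast; linarith
    linarith

lemma kloos_weighted_fin (c : ℕ) (hc : 0 < c) (n : ℤ) (K : ℝ) (hK : 0 < K) (Q : ℕ) :
    ∑ m ∈ Finset.range (Q * c), (1 / (1 + (m:ℝ) / K)) ^ 2 * ‖kloos n (m : ℤ) c‖ ^ 2
      ≤ (c:ℝ)^2 * ∑ q ∈ Finset.range Q, (1 / (1 + q * (c / K))) ^ 2 := by
  induction Q with
  | zero => simp
  | succ Q ih =>
    rw [add_mul, one_mul, Finset.sum_range_add, Finset.sum_range_succ, mul_add]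
    refine add_le_add ih ?_
    calc _ ≤ ∑ r ∈ Finset.range c, (1 / (1 + Q * (c / K))) ^ 2 * ‖kloos n ((Q * c + r : ℕ) : ℤ) c‖ ^ 2 := by
          apply Finset.sum_le_sum; intro r _
          gcongr
          rw [← mul_div_assoc]
          gcongr
          push_cast; linarith [(Nat.cast_nonneg r : (0:ℝ) ≤ r)]
      _ = (1 / (1 + Q * (c / K))) ^ 2 * ∑ r ∈ Finset.range c, ‖kloos n ((Q * c + r : ℕ) : ℤ) c‖ ^ 2 := by
          rw [Finset.mul_sum]
      _ ≤ (1 / (1 + Q * (c / K))) ^ 2 * (c:ℝ)^2 := by gcongr; exact kloos_block c hc n Q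
      _ = _ := by ring

lemma kloos_weighted (c : ℕ) (hc : 0 < c) (n : ℤ) (K : ℝ) (hK : 0 < K) (N : ℕ) :
    ∑ m ∈ Finset.range N, (1 / (1 + (m:ℝ) / K)) ^ 2 * ‖kloos n (m : ℤ) c‖ ^ 2 ≤ (c:ℝ)^2 + K * c := by
  have hc' : (0:ℝ) < c := by exact_mod_cast hc
  calc _ ≤ ∑ m ∈ Finset.range ((N+1) * c), (1 / (1 + (m:ℝ) / K)) ^ 2 * ‖kloos n (m : ℤ) c‖ ^ 2 := by
        apply Finset.sum_le_sum_of_subset_of_nonneg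
        · apply Finset.range_subset_range.2; nlinarith
        · intros; positivity
    _ ≤ _ := kloos_weighted_fin c hc n K hK (N+1)
    _ ≤ (c:ℝ)^2 * (1 + 1 / (c/K)) := by
        gcongr
        refine (sum_inv_sq (c/K) (by positivity) N).trans ?_
        have : 0 ≤ 1 / ((c:ℝ)/K) * (1 / (1 + N * (c/K))) := by positivity
        linarith
    _ = _ := by field_simp

end

section
open MeasureTheory

lemma norm_Gamma_le' (z : ℂ) (hz : 0 < z.re) : ‖Complex.Gamma z‖ ≤ Real.Gamma z.re := by
  rw [Complex.Gamma_eq_integral hz, Real.Gamma_eq_integral hz, Complex.GammaIntegral]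
  refine (norm_integral_le_integral_norm _).trans (le_of_eq ?_)
  apply setIntegral_congr_fun measurableSet_Ioi
  intro x hx
  simp only [norm_mul]
  rw [Complex.norm_cpow_eq_rpow_re_of_pos hx, Complex.norm_real, Real.norm_of_nonneg (Real.exp_pos _).le]
  simp

lemma one_le_normsq (t a : ℝ) (ha : 0 ≤ a) : Real.sqrt (1 + t ^ 2) ≤ ‖((a:ℂ) + (1 + t * Complex.I))‖ := by
  rw [Complex.norm_def]
  apply Real.sqrt_le_sqrt
  rw [Complex.normSq_apply]
  simp
  nlinarith

lemma Gamma_vert_bound (a t : ℝ) (ha : 0 ≤ a) :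
    ‖Complex.Gamma ((a:ℂ) + (1 + t * Complex.I))‖ ≤ Real.Gamma (a + 3) * (1 + t ^ 2)⁻¹ := by
  set z : ℂ := (a:ℂ) + (1 + t * Complex.I) with hz
  have hre : z.re = a + 1 := by simp [hz]
  have h1 := one_le_normsq t a ha
  rw [← hz] at h1
  have h2 := one_le_normsq t (a + 1) (by linarith)
  have e2 : (((a + 1 : ℝ):ℂ) + (1 + t * Complex.I)) = z + 1 := by rw [hz]; push_cast; ring
  rw [e2] at h2
  have hs : 0 < Real.sqrt (1 + t^2) := Real.sqrt_pos.2 (by positivity)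
  have z0 : z ≠ 0 := by rw [← norm_pos_iff]; linarith
  have z1 : z + 1 ≠ 0 := by rw [← norm_pos_iff]; linarith
  have e3 : Complex.Gamma (z + 1 + 1) = (z + 1) * (z * Complex.Gamma z) := by
    rw [Complex.Gamma_add_one _ z1, Complex.Gamma_add_one _ z0]
  have h3 := norm_Gamma_le' (z + 1 + 1) (by simp [hre]; linarith)
  have e4 : (z + 1 + 1).re = a + 3 := by simp [hre]; ring
  rw [e4, e3, norm_mul, norm_mul] at h3
  rw [← div_eq_mul_inv, le_div_iff₀ (by positivity)]
  refine le_trans ?_ h3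
  have e5 : (1 + t^2) = Real.sqrt (1 + t^2) * Real.sqrt (1 + t^2) := by
    rw [Real.mul_self_sqrt]; positivity
  calc ‖Complex.Gamma z‖ * (1 + t^2) = Real.sqrt (1 + t^2) * (Real.sqrt (1 + t^2) * ‖Complex.Gamma z‖) := by
        rw [← mul_assoc, ← e5]; ring
    _ ≤ _ := by gcongr

lemma Gamma_vert_cont (a : ℝ) (ha : 0 ≤ a) :
    Continuous fun t : ℝ => Complex.Gamma ((a:ℂ) + (1 + t * Complex.I)) := by
  rw [continuous_iff_continuousAt]
  intro t
  have : ContinuousAt Complex.Gamma ((a:ℂ) + (1 + t * Complex.I)) := by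
    apply DifferentiableAt.continuousAt (𝕜 := ℂ)
    apply Complex.differentiableAt_Gamma
    intro m h
    have := congrArg Complex.re h
    simp at this
    have hm : (0:ℝ) ≤ m := by positivity
    linarith
  exact ContinuousAt.comp (f := fun t : ℝ => (a:ℂ) + (1 + t * Complex.I)) this (by fun_prop)

lemma Gamma_vert_int (a : ℝ) (ha : 0 ≤ a) :
    Integrable fun t : ℝ => Complex.Gamma ((a:ℂ) + (1 + t * Complex.I)) := by
  refine Integrable.mono' ((integrable_inv_one_add_sq).const_mul (Real.Gamma (a+3)))
    (Gamma_vert_cont a ha).aestronglyMeasurable ?_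
  filter_upwards with t
  exact Gamma_vert_bound a t ha

lemma y_cpow_norm (y t : ℝ) (hy : 0 < y) : ‖(y:ℂ) ^ (-(1 + t * Complex.I) : ℂ)‖ = y⁻¹ := by
  rw [Complex.norm_cpow_eq_rpow_re_of_pos hy]
  simp [Real.rpow_neg_one]

lemma y_cpow_cont (y : ℝ) (hy : 0 < y) : Continuous fun t : ℝ => (y:ℂ) ^ (-(1 + t * Complex.I) : ℂ) := by
  apply Continuous.const_cpow (by fun_prop)
  left; exact_mod_cast hy.ne'

lemma int_mul_cpow (F : ℝ → ℂ) (hF : Integrable F) (y : ℝ) (hy : 0 < y) :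
    Integrable fun t : ℝ => F t * (y:ℂ) ^ (-(1 + t * Complex.I) : ℂ) := by
  refine hF.mul_bdd (c := y⁻¹) (y_cpow_cont y hy).aestronglyMeasurable ?_
  filter_upwards with t
  rw [y_cpow_norm y t hy]

lemma gamma_inv (n : ℕ) (y : ℝ) (hy : 0 < y) :
    ((y ^ n * Real.exp (-y) : ℝ) : ℂ) = (1 / (2 * Real.pi) : ℝ) *
      ∫ t : ℝ, Complex.Gamma (((n:ℝ):ℂ) + (1 + t * Complex.I)) * (y:ℂ) ^ (-(1 + t * Complex.I) : ℂ) := by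
  have hm : ∀ s : ℂ, 0 < s.re → mellin (fun t : ℝ => (t:ℂ) ^ (n:ℂ) • ((Real.exp (-t) : ℝ) : ℂ)) s = Complex.Gamma (n + s) := by
    intro s hs
    rw [mellin_cpow_smul, ← Complex.GammaIntegral_eq_mellin, ← Complex.Gamma_eq_integral, add_comm]
    simp; positivity
  have h := mellinInv_mellin_eq 1 (fun t : ℝ => (t:ℂ) ^ (n:ℂ) • ((Real.exp (-t) : ℝ) : ℂ)) hy ?_ ?_ ?_
  · rw [mellinInv] at h
    simp only [smul_eq_mul] at h
    rw [Complex.cpow_natCast] at h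
    push_cast at h ⊢
    rw [← h, Complex.real_smul]
    push_cast
    congr 1
    apply integral_congr_ae
    filter_upwards with t
    have := hm (1 + t * Complex.I) (by simp)
    simp only [smul_eq_mul] at this
    push_cast at this
    rw [this, mul_comm]
  · unfold MellinConvergent
    have := Complex.GammaIntegral_convergent (s := (n:ℂ) + 1) (by simp; positivity)
    refine this.congr_fun ?_ measurableSet_Ioi
    intro t ht
    simp
    ring
  · unfold Complex.VerticalIntegrable
    refine (Gamma_vert_int n (by positivity)).congr ?_
    filter_upwards with t
    rw [hm _ (by simp)]
    push_cast; rfl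
  · simp only [Complex.cpow_natCast]
    fun_prop

end

section
open MeasureTheory

noncomputable def P1 (k : ℕ) (y : ℝ) : ℝ := ∑ j ∈ Finset.range k, y ^ j * Real.exp (-y) / (j.factorial : ℝ)

lemma Gamma_frac (s : ℂ) (hs : 0 < s.re) (k : ℕ) :
    Complex.Gamma (((k+1 : ℕ):ℂ) + s) / (k.factorial : ℂ) / s
      = ∑ j ∈ Finset.range (k+1), Complex.Gamma ((j:ℂ) + s) / (j.factorial : ℂ) := by
  have s0 : s ≠ 0 := by rintro rfl; simp at hs
  induction k with
  | zero =>
    simp [add_comm (1:ℂ) s, Complex.Gamma_add_one s s0, s0]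
  | succ k ih =>
    rw [Finset.sum_range_succ, ← ih]
    have e : (((k+1+1 : ℕ):ℂ) + s) = (((k+1:ℕ):ℂ) + s) + 1 := by push_cast; ring
    have h0 : (((k+1:ℕ):ℂ) + s) ≠ 0 := by
      intro h
      have := congrArg Complex.re h
      simp at this
      have hm : (0:ℝ) ≤ k := by positivity
      linarith
    rw [e, Complex.Gamma_add_one _ h0, Nat.factorial_succ]
    have hk : (k.factorial : ℂ) ≠ 0 := by exact_mod_cast k.factorial_ne_zero
    have hk1 : ((k:ℂ) + 1) ≠ 0 := by exact_mod_cast (Nat.succ_ne_zero k)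
    push_cast
    field_simp

lemma two_pi_cpow (ξ : ℝ) (hξ : 0 < ξ) (s : ℂ) :
    (2 * Real.pi : ℂ) ^ (-s) * (ξ:ℂ) ^ (-s) = ((2 * Real.pi * ξ : ℝ) : ℂ) ^ (-s) := by
  have := Complex.mul_cpow_ofReal_nonneg (a := 2 * Real.pi) (b := ξ) (by positivity) hξ.le (-s)
  push_cast at this ⊢
  exact this.symm

lemma Lam1_ratio (k : ℕ) (s : ℂ) :
    Lam 1 ((k+1:ℕ):ℝ) (1/2 + s) / Lam 1 ((k+1:ℕ):ℝ) (1/2)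
      = (2 * Real.pi : ℂ) ^ (-s) * (Complex.Gamma (((k+1 : ℕ):ℂ) + s) / (k.factorial : ℂ)) := by
  unfold Lam
  simp only [if_true]
  have p0 : (2 * Real.pi : ℂ) ≠ 0 := by
    have := Real.pi_ne_zero
    simp [this]
  have e1 : (1/2 + s + (((k+1:ℕ):ℝ):ℂ) - 1/2) = ((k+1 : ℕ):ℂ) + s := by push_cast; ring
  have e2 : ((1:ℂ)/2 + (((k+1:ℕ):ℝ):ℂ) - 1/2) = (k:ℂ) + 1 := by push_cast; ring
  rw [e1, e2, Complex.Gamma_nat_eq_factorial]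
  have e3 : -(1/2 + s) = -s + (-(1/2)) := by ring
  rw [e3, Complex.cpow_add _ _ p0]
  have : (2 * Real.pi : ℂ) ^ (-(1/2) : ℂ) ≠ 0 := by
    rw [Complex.cpow_ne_zero_iff]; left; exact p0
  have hk : (k.factorial : ℂ) ≠ 0 := by exact_mod_cast k.factorial_ne_zero
  field_simp

lemma V1_eq (k : ℕ) (hk : 1 ≤ k) (ξ : ℝ) (hξ : 0 < ξ) : V 1 (k:ℝ) ξ = (P1 k (2 * Real.pi * ξ) : ℂ) := by
  obtain ⟨k, rfl⟩ : ∃ q, k = q + 1 := ⟨k - 1, by omega⟩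
  have hy : 0 < 2 * Real.pi * ξ := by positivity
  unfold V P1
  have e : ∀ t : ℝ, (Lam 1 ((k+1:ℕ):ℝ) (1/2 + (1 + (t:ℂ) * Complex.I)) / Lam 1 ((k+1:ℕ):ℝ) (1/2)) *
      (ξ : ℂ) ^ (-(1 + (t:ℂ) * Complex.I)) / (1 + (t:ℂ) * Complex.I) * Complex.I
      = Complex.I * ∑ j ∈ Finset.range (k+1), (1 / (j.factorial : ℂ)) * (Complex.Gamma (((j:ℝ):ℂ) + (1 + t * Complex.I)) *
        ((2 * Real.pi * ξ : ℝ):ℂ) ^ (-(1 + t * Complex.I) : ℂ)) := by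
    intro t
    have h1 := Gamma_frac (1 + t * Complex.I) (by simp) k
    rw [Lam1_ratio, ← two_pi_cpow ξ hξ]
    have h2 : ∑ j ∈ Finset.range (k+1), (1 / (j.factorial : ℂ)) * (Complex.Gamma (((j:ℝ):ℂ) + (1 + t * Complex.I)) *
        ((2 * Real.pi : ℂ) ^ (-(1 + t * Complex.I)) * (ξ:ℂ) ^ (-(1 + t * Complex.I)))) = 
        ((2 * Real.pi : ℂ) ^ (-(1 + t * Complex.I)) * (ξ:ℂ) ^ (-(1 + t * Complex.I))) *
        ∑ j ∈ Finset.range (k+1), Complex.Gamma ((j:ℂ) + (1 + t * Complex.I)) / (j.factorial : ℂ) := by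
      rw [Finset.mul_sum]
      apply Finset.sum_congr rfl; intro j _
      push_cast; ring
    rw [h2, ← h1]; ring
  simp_rw [e]
  rw [integral_const_mul, integral_finsetSum]
  · simp_rw [integral_const_mul]
    push_cast
    rw [Finset.mul_sum, Finset.mul_sum]
    apply Finset.sum_congr rfl
    intro j _
    have := gamma_inv j _ hy
    push_cast at this
    rw [this]
    have := Complex.I_ne_zero
    field_simp
  · intro j _
    exact (int_mul_cpow _ (Gamma_vert_int j (by positivity)) _ hy).const_mul _

lemma P1_nonneg (k : ℕ) (y : ℝ) (hy : 0 ≤ y) : 0 ≤ P1 k y := by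
  unfold P1; apply Finset.sum_nonneg; intros; positivity

lemma P1_mono (y : ℝ) (hy : 0 ≤ y) : Monotone fun k => P1 k y := by
  apply monotone_nat_of_le_succ
  intro k
  unfold P1
  rw [Finset.sum_range_succ]
  have : 0 ≤ y ^ k * Real.exp (-y) / (k.factorial : ℝ) := by positivity
  linarith

lemma P1_le_one (k : ℕ) (y : ℝ) (hy : 0 ≤ y) : P1 k y ≤ 1 := by
  have h := Real.sum_le_exp_of_nonneg hy k
  have : P1 k y = (∑ j ∈ Finset.range k, y ^ j / (j.factorial : ℝ)) * Real.exp (-y) := by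
    unfold P1; rw [Finset.sum_mul]; apply Finset.sum_congr rfl; intros; ring
  rw [this]
  calc _ ≤ Real.exp y * Real.exp (-y) := by gcongr
    _ = 1 := by rw [← Real.exp_add]; simp

lemma P1_decay (k : ℕ) (y : ℝ) (hy : 0 < y) : P1 k y ≤ ((k + 2) / y) ^ 3 := by
  have h : P1 k y ≤ ((k + 2) / y) ^ 3 * P1 (k + 3) y := by
    unfold P1
    rw [Finset.sum_range_succ', Finset.sum_range_succ', Finset.sum_range_succ', mul_add, mul_add, mul_add]
    have : ∑ j ∈ Finset.range k, y ^ j * Real.exp (-y) / (j.factorial : ℝ) ≤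
      ((k + 2) / y) ^ 3 * ∑ j ∈ Finset.range k, y ^ (j + 1 + 1 + 1) * Real.exp (-y) / ((j + 1 + 1 + 1).factorial : ℝ) := by
      rw [Finset.mul_sum]
      apply Finset.sum_le_sum
      intro j hj
      have hjk : (j:ℝ) + 1 ≤ k := by exact_mod_cast (Finset.mem_range.1 hj)
      have hf : (0:ℝ) < j.factorial := by exact_mod_cast j.factorial_pos
      have e : ((k + 2) / y) ^ 3 * (y ^ (j + 1 + 1 + 1) * Real.exp (-y) / ((j + 1 + 1 + 1).factorial : ℝ))
        = (((k:ℝ) + 2)^3 / ((j+1)*(j+2)*(j+3))) * (y ^ j * Real.exp (-y) / (j.factorial : ℝ)) := by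
        simp only [Nat.factorial_succ]
        push_cast
        have : (j:ℝ) + 1 + 1 ≠ 0 := by positivity
        have : (j:ℝ) + 1 + 1 + 1 ≠ 0 := by positivity
        field_simp
        ring
      rw [e]
      have h0 : 0 ≤ (y ^ j * Real.exp (-y) / (j.factorial : ℝ)) := by positivity
      refine le_mul_of_one_le_left h0 ?_
      rw [one_le_div (by positivity)]
      have j0 : (0:ℝ) ≤ j := by positivity
      have a1 : (j:ℝ)+1 ≤ k+2 := by linarith
      have a2 : (j:ℝ)+2 ≤ k+2 := by linarith
      have a3 : (j:ℝ)+3 ≤ k+2 := by linarith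
      rw [show ((k:ℝ)+2)^3 = (k+2) * (k+2) * (k+2) by ring]
      exact mul_le_mul (mul_le_mul a1 a2 (by positivity) (by positivity)) a3 (by positivity) (by positivity)
    have h1 : 0 ≤ ((k + 2) / y) ^ 3 * (y ^ (0 + 1 + 1) * Real.exp (-y) / ((0 + 1 + 1).factorial : ℝ)) := by positivity
    have h2 : 0 ≤ ((k + 2) / y) ^ 3 * (y ^ (0 + 1) * Real.exp (-y) / ((0 + 1).factorial : ℝ)) := by positivity
    have h3 : 0 ≤ ((k + 2) / y) ^ 3 * (y ^ 0 * Real.exp (-y) / ((0).factorial : ℝ)) := by positivity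
    linarith
  refine h.trans ?_
  refine mul_le_of_le_one_right (by positivity) (P1_le_one _ _ hy.le)

end

section
open MeasureTheory Set

structure Nice (f : ℝ → ℝ) : Prop where
  nonneg : ∀ y, 0 < y → 0 ≤ f y
  le_one : ∀ y, 0 < y → f y ≤ 1
  anti : AntitoneOn f (Ioi 0)

noncomputable def TT (n : ℕ) (f : ℝ → ℝ) (y : ℝ) : ℝ :=
  (1 / (n.factorial : ℝ)) * ∫ u in Ioi (0:ℝ), u ^ n * Real.exp (-u) * f (y / u)

lemma pow_exp_int (n : ℕ) : IntegrableOn (fun u : ℝ => u ^ n * Real.exp (-u)) (Ioi 0) := by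
  have := Real.GammaIntegral_convergent (s := (n:ℝ) + 1) (by positivity)
  refine this.congr_fun ?_ measurableSet_Ioi
  intro u _
  simp [mul_comm]

lemma pow_exp_integral (n : ℕ) : ∫ u in Ioi (0:ℝ), u ^ n * Real.exp (-u) = n.factorial := by
  rw [← Real.Gamma_nat_eq_factorial, Real.Gamma_eq_integral (by positivity)]
  apply setIntegral_congr_fun measurableSet_Ioi
  intro u _
  simp [mul_comm]

lemma Nice.meas {f : ℝ → ℝ} (hf : Nice f) (y : ℝ) (hy : 0 < y) :
    AEStronglyMeasurable (fun u => f (y / u)) (volume.restrict (Ioi 0)) := by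
  apply AEMeasurable.aestronglyMeasurable
  apply aemeasurable_restrict_of_monotoneOn measurableSet_Ioi
  intro u hu v hv huv
  apply hf.anti
  · exact div_pos hy hv
  · exact div_pos hy hu
  · have : 0 < u := hu
    gcongr

lemma Nice.int {f : ℝ → ℝ} (hf : Nice f) (n : ℕ) (y : ℝ) (hy : 0 < y) :
    IntegrableOn (fun u : ℝ => u ^ n * Real.exp (-u) * f (y / u)) (Ioi 0) := by
  refine (pow_exp_int n).mul_bdd (c := 1) (hf.meas y hy) ?_
  filter_upwards [ae_restrict_mem measurableSet_Ioi] with u hu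
  have : 0 < y / u := div_pos hy hu
  rw [Real.norm_of_nonneg (hf.nonneg _ this)]
  exact hf.le_one _ this

lemma TT_mono_f {f g : ℝ → ℝ} (hf : Nice f) (hg : Nice g) (h : ∀ y, 0 < y → f y ≤ g y) (n : ℕ)
    (y : ℝ) (hy : 0 < y) : TT n f y ≤ TT n g y := by
  unfold TT
  gcongr 1 / _ * ?_
  apply setIntegral_mono_on (hf.int n y hy) (hg.int n y hy) measurableSet_Ioi
  intro u hu
  have hu' : 0 < u := hu
  have := h (y / u) (div_pos hy hu)
  gcongr

lemma TT_nice {f : ℝ → ℝ} (hf : Nice f) (n : ℕ) : Nice (TT n f) := by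
  have hfac : (0:ℝ) < n.factorial := by exact_mod_cast n.factorial_pos
  constructor
  · intro y hy
    unfold TT
    apply mul_nonneg (by positivity)
    apply setIntegral_nonneg measurableSet_Ioi
    intro u hu
    have hu' : 0 < u := hu
    have := hf.nonneg (y / u) (div_pos hy hu)
    positivity
  · intro y hy
    unfold TT
    rw [one_div, inv_mul_le_iff₀ hfac, mul_one, ← pow_exp_integral n]
    apply setIntegral_mono_on (hf.int n y hy) (pow_exp_int n) measurableSet_Ioi
    intro u hu
    have hu' : 0 < u := hu
    have := hf.le_one (y / u) (div_pos hy hu)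
    exact mul_le_of_le_one_right (by positivity) this
  · intro y hy z hz hyz
    have hy' : 0 < y := hy
    have hz' : 0 < z := hz
    unfold TT
    gcongr 1 / _ * ?_
    apply setIntegral_mono_on (hf.int n z hz') (hf.int n y hy') measurableSet_Ioi
    intro u hu
    have hu' : 0 < u := hu
    have : f (z / u) ≤ f (y / u) := by
      apply hf.anti (div_pos hy' hu') (div_pos hz' hu')
      gcongr
    gcongr

lemma TT_mono_n {f : ℝ → ℝ} (hf : Nice f) (n : ℕ) (y : ℝ) (hy : 0 < y) :
    TT n f y ≤ TT (n+1) f y := by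
  have hfac : (0:ℝ) < n.factorial := by exact_mod_cast n.factorial_pos
  have n1 : (0:ℝ) < (n:ℝ) + 1 := by positivity
  set c := f (y / (n+1)) with hc
  have hi1 := hf.int (n+1) y hy
  have hi0 := hf.int n y hy
  have key : ∫ u in Ioi (0:ℝ), (((n:ℝ)+1) * (u ^ n * Real.exp (-u) * f (y / u))
      + c * (u ^ (n+1) * Real.exp (-u) - (n+1) * (u ^ n * Real.exp (-u)))) ≤
      ∫ u in Ioi (0:ℝ), u ^ (n+1) * Real.exp (-u) * f (y / u) := by
    apply setIntegral_mono_on _ hi1 measurableSet_Ioi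
    · intro u hu
      have hu' : 0 < u := hu
      have h1 : 0 ≤ (u - (n+1)) * (f (y/u) - c) := by
        rcases le_total u (n+1) with h | h
        · have : f (y / u) ≤ c := by
            apply hf.anti (div_pos hy n1) (div_pos hy hu')
            gcongr
          exact mul_nonneg_of_nonpos_of_nonpos (by linarith) (by linarith)
        · have : c ≤ f (y / u) := by
            apply hf.anti (div_pos hy hu') (div_pos hy n1)
            gcongr
          exact mul_nonneg (by linarith) (by linarith)
      have h2 : 0 ≤ u ^ n * Real.exp (-u) * ((u - (n+1)) * (f (y/u) - c)) := by positivity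
      rw [pow_succ]
      nlinarith
    · exact (hi0.const_mul _).add ((((pow_exp_int (n+1))).sub ((pow_exp_int n).const_mul _)).const_mul _)
  have hsub : IntegrableOn (fun u : ℝ => c * (u ^ (n+1) * Real.exp (-u) - (n+1) * (u ^ n * Real.exp (-u)))) (Ioi 0) :=
    (((pow_exp_int (n+1))).sub ((pow_exp_int n).const_mul _)).const_mul _
  rw [integral_add (hi0.const_mul _) hsub,
    integral_const_mul, integral_const_mul, integral_sub (pow_exp_int (n+1)) ((pow_exp_int n).const_mul _),
    integral_const_mul, pow_exp_integral, pow_exp_integral, Nat.factorial_succ] at key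
  push_cast at key
  rw [sub_self, mul_zero, add_zero] at key
  unfold TT
  rw [Nat.factorial_succ, one_div_mul_eq_div, one_div_mul_eq_div, le_div_iff₀ (by positivity)]
  push_cast
  refine le_trans (le_of_eq ?_) key
  field_simp

lemma TT_decay {f : ℝ → ℝ} (hf : Nice f) (C : ℝ) (h : ∀ y, 0 < y → f y ≤ C / y) (n : ℕ)
    (y : ℝ) (hy : 0 < y) : TT n f y ≤ (C * (n + 1)) / y := by
  have hfac : (0:ℝ) < n.factorial := by exact_mod_cast n.factorial_pos
  have key : ∫ u in Ioi (0:ℝ), u ^ n * Real.exp (-u) * f (y / u) ≤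
      ∫ u in Ioi (0:ℝ), (C / y) * (u ^ (n+1) * Real.exp (-u)) := by
    apply setIntegral_mono_on (hf.int n y hy) ((pow_exp_int (n+1)).const_mul _) measurableSet_Ioi
    intro u hu
    have hu' : 0 < u := hu
    have h1 := h (y / u) (div_pos hy hu)
    calc u ^ n * Real.exp (-u) * f (y / u) ≤ u ^ n * Real.exp (-u) * (C / (y / u)) := by gcongr
      _ = _ := by field_simp; ring
  rw [integral_const_mul, pow_exp_integral, Nat.factorial_succ] at key
  push_cast at key
  unfold TT
  rw [one_div_mul_eq_div, div_le_iff₀ hfac]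
  refine key.trans (le_of_eq ?_)
  field_simp

lemma exp_nice : Nice (fun y => Real.exp (-y)) := by
  constructor
  · intro y _; positivity
  · intro y hy; simp [hy.le]
  · intro y _ z _ h
    simpa using h

noncomputable def P2 (k : ℕ) (y : ℝ) : ℝ := TT (2 * k) (TT k (fun y => Real.exp (-y))) y

lemma P2_nice (k : ℕ) : Nice (P2 k) := TT_nice (TT_nice exp_nice k) (2 * k)

lemma P2_mono (y : ℝ) (hy : 0 < y) : Monotone fun k => P2 k y := by
  apply monotone_nat_of_le_succ
  intro k
  have a := TT_nice exp_nice k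
  have b := TT_nice exp_nice (k+1)
  unfold P2
  calc _ ≤ TT (2 * k) (TT (k+1) (fun y => Real.exp (-y))) y :=
        TT_mono_f a b (fun z hz => TT_mono_n exp_nice k z hz) _ y hy
    _ ≤ TT (2 * k + 1) (TT (k+1) (fun y => Real.exp (-y))) y := TT_mono_n b _ y hy
    _ ≤ TT (2 * k + 1 + 1) (TT (k+1) (fun y => Real.exp (-y))) y := TT_mono_n b _ y hy

lemma P2_decay (k : ℕ) (y : ℝ) (hy : 0 < y) : P2 k y ≤ ((k + 1) * (2 * k + 1)) / y := by
  have h := TT_decay (TT_nice exp_nice k) ((k:ℝ) + 1) (fun z hz => ?_) (2 * k) y hy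
  · push_cast at h; exact h
  · have := TT_decay exp_nice 1 (fun z hz => ?_) k z hz
    · simpa using this
    · rw [Real.exp_neg, one_div]
      apply inv_anti₀ hz
      linarith [Real.add_one_le_exp z]

def HasInv (f : ℝ → ℝ) (F : ℝ → ℂ) : Prop := Integrable F ∧ ∀ y, 0 < y →
  (f y : ℂ) = (1 / (2 * Real.pi) : ℝ) * ∫ t : ℝ, F t * (y:ℂ) ^ (-(1 + t * Complex.I) : ℂ)

lemma exp_hasInv : HasInv (fun y => Real.exp (-y)) (fun t => Complex.Gamma (1 + t * Complex.I)) := by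
  constructor
  · simpa using Gamma_vert_int 0 le_rfl
  · intro y hy
    simpa using gamma_inv 0 y hy

lemma TT_hasInv {f : ℝ → ℝ} {F : ℝ → ℂ} (h : HasInv f F) (n : ℕ) :
    HasInv (TT n f) (fun t => F t * (Complex.Gamma (((n + 1 : ℕ):ℂ) + (1 + t * Complex.I)) / (n.factorial : ℂ))) := by
  obtain ⟨hF, hf⟩ := h
  constructor
  · apply hF.mul_bdd (c := Real.Gamma (n + 1 + 1) / n.factorial)
    · apply Continuous.aestronglyMeasurable
      have := Gamma_vert_cont ((n + 1 : ℕ):ℝ) (by positivity)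
      push_cast at this ⊢
      exact this.div_const _
    · filter_upwards with t
      rw [norm_div, Complex.norm_natCast]
      gcongr
      have := norm_Gamma_le' (((n + 1 : ℕ):ℂ) + (1 + t * Complex.I)) (by simp; positivity)
      simpa using this
  · intro y hy
    unfold TT
    push_cast
    rw [← integral_complex_ofReal]
    have e1 : ∫ u in Ioi (0:ℝ), ((u ^ n * Real.exp (-u) * f (y / u) : ℝ) : ℂ)
        = ∫ u in Ioi (0:ℝ), (1 / (2 * Real.pi) : ℝ) * ∫ t : ℝ,
          ((u ^ (n+1) * Real.exp (-u) : ℝ) : ℂ) * (F t * (y:ℂ) ^ (-(1 + t * Complex.I) : ℂ))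
            * (u:ℂ) ^ (t * Complex.I) := by
      apply setIntegral_congr_fun measurableSet_Ioi
      intro u hu
      have hu' : 0 < u := hu
      simp only
      rw [Complex.ofReal_mul, hf _ (div_pos hy hu'), mul_left_comm]
      congr 1
      rw [← integral_const_mul]
      congr 1; ext t
      have u0 : (u:ℂ) ≠ 0 := by exact_mod_cast hu'.ne'
      have e2 : ((y / u : ℝ):ℂ) ^ (-(1 + t * Complex.I) : ℂ)
          = (y:ℂ) ^ (-(1 + t * Complex.I) : ℂ) * (u * (u:ℂ) ^ (t * Complex.I)) := by
        rw [div_eq_mul_inv, Complex.ofReal_mul, Complex.mul_cpow_ofReal_nonneg hy.le (by positivity)]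
        congr 1
        rw [Complex.ofReal_inv, Complex.inv_cpow _ _ (by rw [Complex.arg_ofReal_of_nonneg hu'.le]; exact Real.pi_pos.ne),
          Complex.cpow_neg, inv_inv, Complex.cpow_add _ _ u0, Complex.cpow_one]
      rw [e2]; push_cast; ring
    rw [e1, integral_const_mul, integral_integral_swap]
    · rw [mul_left_comm, ← integral_const_mul]
      push_cast
      congr 1
      congr 1; ext t
      have e3 : ∀ u : ℝ, (u:ℂ) ^ (n+1) * Complex.exp (-u) * (F t * (y:ℂ) ^ (-(1 + t * Complex.I) : ℂ))
            * (u:ℂ) ^ (t * Complex.I) = (F t * (y:ℂ) ^ (-(1 + t * Complex.I) : ℂ)) *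
            ((u:ℂ) ^ (n+1) * Complex.exp (-u) * (u:ℂ) ^ (t * Complex.I)) := by intro u; ring
      simp_rw [e3]
      rw [integral_const_mul, Complex.Gamma_eq_integral (by simp; positivity), Complex.GammaIntegral]
      have e4 : ∫ u in Ioi (0:ℝ), ((u:ℂ) ^ (n+1) * Complex.exp (-u) * (u:ℂ) ^ (t * Complex.I))
          = ∫ x in Ioi (0:ℝ), ((Real.exp (-x) : ℝ):ℂ) * (x:ℂ) ^ ((n:ℂ) + 1 + (1 + t * Complex.I) - 1) := by
        apply setIntegral_congr_fun measurableSet_Ioi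
        intro u hu
        have hu' : 0 < u := hu
        have u0 : (u:ℂ) ≠ 0 := by exact_mod_cast hu'.ne'
        simp only
        rw [show ((n:ℂ) + 1 + (1 + t * Complex.I) - 1) = ((n+1:ℕ):ℂ) + t * Complex.I by push_cast; ring,
          Complex.cpow_add _ _ u0, Complex.cpow_natCast]
        push_cast; ring
      rw [e4]; ring
    · have hprod : Integrable (fun p : ℝ × ℝ => (((p.1 ^ (n+1) * Real.exp (-p.1) : ℝ) : ℂ) *
          (F p.2 * (y:ℂ) ^ (-(1 + p.2 * Complex.I) : ℂ)))) ((volume.restrict (Ioi 0)).prod volume) :=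
        Integrable.mul_prod (f := fun u : ℝ => ((u ^ (n+1) * Real.exp (-u) : ℝ) : ℂ))
          (g := fun t : ℝ => (F t * (y:ℂ) ^ (-(1 + t * Complex.I) : ℂ)))
          (pow_exp_int (n+1)).ofReal (int_mul_cpow F hF y hy)
      refine hprod.mul_bdd (c := 1) ?_ ?_
      · apply Measurable.aestronglyMeasurable
        fun_prop
      · have : ∀ᵐ p : ℝ × ℝ ∂((volume.restrict (Ioi 0)).prod volume), p.1 ∈ Ioi (0:ℝ) := by
          have := (Measure.quasiMeasurePreserving_fst (μ := volume.restrict (Ioi (0:ℝ))) (ν := (volume : Measure ℝ))).ae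
            (ae_restrict_mem measurableSet_Ioi)
          exact this
        filter_upwards [this] with p hp
        rw [Complex.norm_cpow_eq_rpow_re_of_pos hp]
        simp

end

section
open MeasureTheory Set

lemma Lam2_ratio (k : ℕ) (s : ℂ) :
    Lam 2 ((k+1:ℕ):ℝ) (1/2 + s) / Lam 2 ((k+1:ℕ):ℝ) (1/2)
      = (2 * Real.pi : ℂ) ^ (-(3 * s)) * (Complex.Gamma (((2 * k+1 : ℕ):ℂ) + s) / ((2*k).factorial : ℂ))
        * (Complex.Gamma (((k+1 : ℕ):ℂ) + s) / (k.factorial : ℂ)) * Complex.Gamma (s + 1) := by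
  unfold Lam
  rw [if_neg (by norm_num), if_neg (by norm_num)]
  have p0 : (2 * Real.pi : ℂ) ≠ 0 := by
    have := Real.pi_ne_zero
    simp [this]
  have e1 : (1/2 + s + (((k+1:ℕ):ℝ):ℂ) - 1/2) = ((k+1 : ℕ):ℂ) + s := by push_cast; ring
  have e2 : ((1:ℂ)/2 + (((k+1:ℕ):ℝ):ℂ) - 1/2) = (k:ℂ) + 1 := by push_cast; ring
  have e1' : (1/2 + s + 2 * (((k+1:ℕ):ℝ):ℂ) - 3/2) = ((2*k+1 : ℕ):ℂ) + s := by push_cast; ring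
  have e2' : ((1:ℂ)/2 + 2 * (((k+1:ℕ):ℝ):ℂ) - 3/2) = ((2 * k : ℕ):ℂ) + 1 := by push_cast; ring
  have e4 : (1/2 + s + 1/2) = s + 1 := by ring
  have e5 : ((1:ℂ)/2 + 1/2) = 1 := by ring
  rw [e1, e2, e1', e2', e4, e5, Complex.Gamma_nat_eq_factorial, Complex.Gamma_nat_eq_factorial, Complex.Gamma_one]
  have e3 : -3 * (1/2 + s) - 3 * (((k+1:ℕ):ℝ):ℂ) + 3/2 = -(3 * s) + (-3 * (1/2) - 3 * (((k+1:ℕ):ℝ):ℂ) + 3/2) := by ring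
  rw [e3, Complex.cpow_add _ _ p0]
  have : (2 * Real.pi : ℂ) ^ (-3 * (1/2) - 3 * (((k+1:ℕ):ℝ):ℂ) + 3/2 : ℂ) ≠ 0 := by
    rw [Complex.cpow_ne_zero_iff]; left; exact p0
  have hk : (k.factorial : ℂ) ≠ 0 := by exact_mod_cast k.factorial_ne_zero
  have hk' : ((2*k).factorial : ℂ) ≠ 0 := by exact_mod_cast (2*k).factorial_ne_zero
  generalize (2 * Real.pi : ℂ) ^ (-3 * (1/2) - 3 * (((k+1:ℕ):ℝ):ℂ) + 3/2 : ℂ) = X at *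
  field_simp

lemma two_pi_cpow3 (ξ : ℝ) (hξ : 0 < ξ) (s : ℂ) :
    (2 * Real.pi : ℂ) ^ (-(3*s)) * (ξ:ℂ) ^ (-s) = (((2 * Real.pi) ^ 3 * ξ : ℝ) : ℂ) ^ (-s) := by
  have := Complex.mul_cpow_ofReal_nonneg (a := (2 * Real.pi)^3) (b := ξ) (by positivity) hξ.le (-s)
  have h2 : (((2 * Real.pi)^3 : ℝ) : ℂ) ^ (-s) = (2 * Real.pi : ℂ) ^ (-(3*s)) := by
    have h3 := Complex.mul_cpow_ofReal_nonneg (a := (2 * Real.pi)) (b := 2 * Real.pi) (by positivity) (by positivity) (-s)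
    have h4 := Complex.mul_cpow_ofReal_nonneg (a := (2 * Real.pi)) (b := (2 * Real.pi)*(2 * Real.pi)) (by positivity) (by positivity) (-s)
    have p0 : (2 * Real.pi : ℂ) ≠ 0 := by
      have := Real.pi_ne_zero
      simp [this]
    rw [show -(3*s) = -s + (-s + -s) by ring, Complex.cpow_add _ _ p0, Complex.cpow_add _ _ p0]
    push_cast at h3 h4 ⊢
    rw [← h3, ← h4]; congr 1; ring
  rw [← h2, ← this]; push_cast; rfl

lemma V2_eq (k : ℕ) (ξ : ℝ) (hξ : 0 < ξ) :
    V 2 ((k+1:ℕ):ℝ) ξ = (P2 k ((2 * Real.pi)^3 * ξ) : ℂ) := by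
  have hy : 0 < (2 * Real.pi)^3 * ξ := by positivity
  have h := (TT_hasInv (TT_hasInv exp_hasInv k) (2*k)).2 _ hy
  unfold P2
  rw [h]
  unfold V
  have e : ∀ t : ℝ, (Lam 2 ((k+1:ℕ):ℝ) (1/2 + (1 + (t:ℂ) * Complex.I)) / Lam 2 ((k+1:ℕ):ℝ) (1/2)) *
      (ξ : ℂ) ^ (-(1 + (t:ℂ) * Complex.I)) / (1 + (t:ℂ) * Complex.I) * Complex.I
      = Complex.I * (Complex.Gamma (1 + t * Complex.I) *
        (Complex.Gamma (((k + 1 : ℕ):ℂ) + (1 + t * Complex.I)) / (k.factorial : ℂ)) *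
        (Complex.Gamma (((2 * k + 1 : ℕ):ℂ) + (1 + t * Complex.I)) / ((2*k).factorial : ℂ)) *
        (((2 * Real.pi)^3 * ξ : ℝ):ℂ) ^ (-(1 + t * Complex.I) : ℂ)) := by
    intro t
    have s0 : (1 + (t:ℂ) * Complex.I) ≠ 0 := by
      intro h
      have := congrArg Complex.re h
      simp at this
    rw [Lam2_ratio, ← two_pi_cpow3 ξ hξ, Complex.Gamma_add_one _ s0]
    field_simp
  simp_rw [e]
  rw [integral_const_mul, ← mul_assoc]
  congr 1
  have := Complex.I_ne_zero
  push_cast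
  field_simp

end

section
open MeasureTheory Set

lemma a_zero {w : ℝ → ℝ} (hsupp : Function.support w ⊆ Set.Ioo 1 2) {x : ℝ} (h : ¬ (1 < x ∧ x < 2)) : w x = 0 := by
  by_contra hc
  exact h (hsupp hc)

lemma term_bd (w : ℝ → ℝ) (M : ℝ) (hsupp : Function.support w ⊆ Set.Ioo 1 2)
    (hM : ∀ u, |w u| ≤ M) (K : ℝ) (hK : 2 ≤ K) (g : ℕ → ℝ) (hg : Monotone g) (hg0 : ∀ j, 0 ≤ g j)
    (J : ℕ) (x : ℝ) (hx : 0 ≤ x) (j : ℕ) (hj : j ≤ J) :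
    ‖((w (((2 * j : ℕ) : ℝ) / K) * g j : ℝ) : ℂ) * besselJ (2 * (2 * j) - 1) x‖
      ≤ 4 * M * g J * min 1 ((x / K) ^ 2) := by
  have hM0 : 0 ≤ M := (abs_nonneg _).trans (hM 0)
  have hmin : 0 ≤ min 1 ((x / K) ^ 2) := le_min zero_le_one (sq_nonneg _)
  by_cases hw : w (((2 * j : ℕ) : ℝ) / K) = 0
  · rw [hw]; simp only [zero_mul, Complex.ofReal_zero, norm_zero]
    have := hg0 J
    positivity
  have h1 : ‖((w (((2 * j : ℕ) : ℝ) / K) * g j : ℝ) : ℂ)‖ ≤ M * g J := by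
    rw [Complex.norm_real, Real.norm_eq_abs, abs_mul, abs_of_nonneg (hg0 j)]
    exact mul_le_mul (hM _) (hg hj) (hg0 j) hM0
  have h2 : ‖besselJ (2 * (2 * j) - 1) x‖ ≤ 4 * min 1 ((x / K) ^ 2) := by
    by_cases hxK : x ≤ K / 2
    · have hk : K < ((2 * j : ℕ) : ℝ) := by
        have := (hsupp hw).1
        rwa [lt_div_iff₀ (by linarith), one_mul] at this
      have h3 := besselJ_small2 K x hK hx hxK (2 * j) hk
      have hxK1 : x / K ≤ 1 := by rw [div_le_one (by linarith)]; linarith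
      have h0 : 0 ≤ x / K := by positivity
      have h4 : (x / K) ^ 2 ≤ 1 := by nlinarith
      rw [min_eq_right h4]
      refine h3.trans ?_
      rw [div_le_iff₀ (by linarith)]
      nlinarith [sq_nonneg (x / K)]
    · push Not at hxK
      have h3 := besselJ_norm_le (2 * (2 * j) - 1) x
      have h4 : 1 / 2 ≤ x / K := by rw [le_div_iff₀ (by linarith)]; linarith
      have h5 : 1 / 4 ≤ (x / K) ^ 2 := by nlinarith
      have : 1 / 4 ≤ min 1 ((x / K) ^ 2) := le_min (by norm_num) h5
      linarith
  rw [norm_mul]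
  calc _ ≤ (M * g J) * (4 * min 1 ((x / K) ^ 2)) :=
        mul_le_mul h1 h2 (norm_nonneg _) (mul_nonneg hM0 (hg0 J))
    _ = _ := by ring

lemma sum_bd (w : ℝ → ℝ) (M L : ℝ) (hsupp : Function.support w ⊆ Set.Ioo 1 2)
    (hM : ∀ u, |w u| ≤ M) (hL : ∀ u v, |w u - w v| ≤ L * |u - v|) (hL0 : 0 ≤ L)
    (K : ℝ) (hK : 2 ≤ K) (g : ℕ → ℝ) (hg : Monotone g) (hg0 : ∀ j, 0 ≤ g j)
    (J : ℕ) (hJ : K < J) (hJ2 : (J : ℝ) ≤ 2 * K) (x : ℝ) (hx : 0 ≤ x)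
    (δ : ℝ) (hδ : 0 < δ) (hδ1 : δ < 1) :
    ‖∑ j ∈ Finset.range J, ((w (((2 * j : ℕ) : ℝ) / K) * g j : ℝ) : ℂ) * besselJ (2 * (2 * j) - 1) x‖
      ≤ (16 / δ + 16) * (M + 4 * L) * g J * K ^ δ * min 1 ((x / K) ^ 2) := by
  have hM0 : 0 ≤ M := (abs_nonneg _).trans (hM 0)
  have hG := hg0 J
  have hKδ : 1 ≤ K ^ δ := Real.one_le_rpow (by linarith) hδ.le
  have hmin : 0 ≤ min 1 ((x / K) ^ 2) := le_min zero_le_one (sq_nonneg _)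
  by_cases hxK : x ≤ K / 2
  · have hxK1 : x / K ≤ 1 := by rw [div_le_one (by linarith)]; linarith
    have h0 : 0 ≤ x / K := by positivity
    have h4 : (x / K) ^ 2 ≤ 1 := by nlinarith
    rw [min_eq_right h4]
    have hterm : ∀ j ∈ Finset.range J, ‖((w (((2 * j : ℕ) : ℝ) / K) * g j : ℝ) : ℂ) * besselJ (2 * (2 * j) - 1) x‖
        ≤ M * g J * (8 * (x / K) ^ 2 / K) := by
      intro j hj
      by_cases hw : w (((2 * j : ℕ) : ℝ) / K) = 0
      · rw [hw]; simp only [zero_mul, Complex.ofReal_zero, norm_zero]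
        positivity
      have h1 : ‖((w (((2 * j : ℕ) : ℝ) / K) * g j : ℝ) : ℂ)‖ ≤ M * g J := by
        rw [Complex.norm_real, Real.norm_eq_abs, abs_mul, abs_of_nonneg (hg0 j)]
        exact mul_le_mul (hM _) (hg (Finset.mem_range.mp hj).le) (hg0 j) hM0
      have hk : K < ((2 * j : ℕ) : ℝ) := by
        have := (hsupp hw).1
        rwa [lt_div_iff₀ (by linarith), one_mul] at this
      have h3 := besselJ_small2 K x hK hx hxK (2 * j) hk
      rw [norm_mul]
      exact mul_le_mul h1 h3 (norm_nonneg _) (by positivity)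
    refine (norm_sum_le_of_le _ hterm).trans ?_
    rw [Finset.sum_const, Finset.card_range, nsmul_eq_mul]
    have h5 : (J : ℝ) * (M * g J * (8 * (x / K) ^ 2 / K)) ≤ 2 * K * (M * g J * (8 * (x / K) ^ 2 / K)) :=
      mul_le_mul_of_nonneg_right hJ2 (by positivity)
    refine h5.trans ?_
    have h6 : 2 * K * (M * g J * (8 * (x / K) ^ 2 / K)) = 16 * M * g J * 1 * (x / K) ^ 2 := by
      have : K ≠ 0 := by linarith
      field_simp
      ring
    rw [h6]
    have : 0 ≤ 16 / δ := by positivity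
    gcongr
    · linarith
    · linarith
  · push Not at hxK
    have h4 : 1 / 2 ≤ x / K := by rw [le_div_iff₀ (by linarith)]; linarith
    have h5 : 1 / 4 ≤ (x / K) ^ 2 := by nlinarith
    have h6 : 1 / 4 ≤ min 1 ((x / K) ^ 2) := le_min (by norm_num) h5
    have hb := bessel_sum_bound δ hδ hδ1 (fun j => w (((2 * j : ℕ) : ℝ) / K) * g j) J
      (by
        have : w (((2 * 0 : ℕ) : ℝ) / K) = 0 := a_zero hsupp (by norm_num)
        simp only [this, zero_mul])
      (by
        have : w (((2 * J : ℕ) : ℝ) / K) = 0 := a_zero hsupp (by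
          rintro ⟨-, h⟩
          rw [div_lt_iff₀ (by linarith)] at h
          push_cast at h
          linarith)
        simp only [this, zero_mul])
      ((M + 4 * L) * g J) (2 * K) (by positivity) (by linarith)
      (by
        have h7 : ∀ j ∈ Finset.range J, |w (((2 * (j+1) : ℕ) : ℝ) / K) * g (j+1) - w (((2 * j : ℕ) : ℝ) / K) * g j|
            ≤ M * (g (j+1) - g j) + L * (2 / K) * g J := by
          intro j hj
          have e : w (((2 * (j+1) : ℕ) : ℝ) / K) * g (j+1) - w (((2 * j : ℕ) : ℝ) / K) * g j
            = w (((2 * (j+1) : ℕ) : ℝ) / K) * (g (j+1) - g j) + (w (((2 * (j+1) : ℕ) : ℝ) / K) - w (((2 * j : ℕ) : ℝ) / K)) * g j := by ring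
          rw [e]
          refine (abs_add_le _ _).trans (add_le_add ?_ ?_)
          · have : 0 ≤ g (j+1) - g j := sub_nonneg.mpr (hg (Nat.le_succ j))
            rw [abs_mul, abs_of_nonneg this]
            exact mul_le_mul_of_nonneg_right (hM _) this
          · rw [abs_mul, abs_of_nonneg (hg0 j)]
            refine mul_le_mul ?_ (hg (Finset.mem_range.mp hj).le) (hg0 j) (by positivity)
            refine (hL _ _).trans (le_of_eq ?_)
            congr 1
            rw [show ((2 * (j+1) : ℕ) : ℝ) / K - ((2 * j : ℕ) : ℝ) / K = 2 / K by push_cast; ring]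
            exact abs_of_pos (by positivity)
        refine (Finset.sum_le_sum h7).trans ?_
        rw [Finset.sum_add_distrib, ← Finset.mul_sum, Finset.sum_range_sub, Finset.sum_const, Finset.card_range, nsmul_eq_mul]
        have h8 : (J : ℝ) * (L * (2 / K) * g J) ≤ (2 * K) * (L * (2 / K) * g J) :=
          mul_le_mul_of_nonneg_right hJ2 (by positivity)
        have h9 : (2 * K) * (L * (2 / K) * g J) = 4 * L * g J := by
          have : K ≠ 0 := by linarith
          field_simp
          ring
        have := mul_nonneg hM0 (hg0 0)
        nlinarith)
      (by
        have h7 : ∀ j ∈ Finset.range J, |w (((2 * j : ℕ) : ℝ) / K) * g j| ≤ M * g J := by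
          intro j hj
          rw [abs_mul, abs_of_nonneg (hg0 j)]
          exact mul_le_mul (hM _) (hg (Finset.mem_range.mp hj).le) (hg0 j) hM0
        refine (Finset.sum_le_sum h7).trans ?_
        rw [Finset.sum_const, Finset.card_range, nsmul_eq_mul]
        calc (J : ℝ) * (M * g J) ≤ (2 * K) * (M * g J) := mul_le_mul_of_nonneg_right hJ2 (by positivity)
          _ ≤ (2 * K) * ((M + 4 * L) * g J) := by gcongr; linarith
          _ = _ := by ring) x
    refine hb.trans ?_
    have h2 : (2 * K) ^ δ ≤ 2 * K ^ δ := by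
      rw [Real.mul_rpow (by norm_num) (by linarith)]
      gcongr
      calc (2:ℝ) ^ δ ≤ 2 ^ (1:ℝ) := Real.rpow_le_rpow_of_exponent_le (by norm_num) hδ1.le
        _ = 2 := by norm_num
    calc 2 / δ * ((M + 4 * L) * g J) * (2 * K) ^ δ ≤ 2 / δ * ((M + 4 * L) * g J) * (2 * K ^ δ) := by gcongr
      _ = (16 / δ) * (M + 4 * L) * g J * K ^ δ * (1 / 4) := by ring
      _ ≤ _ := by
        gcongr
        linarith

end

section
open MeasureTheory Set

noncomputable def gg (K : ℝ) (m : ℕ) (ξ : ℝ) (j : ℕ) : ℝ :=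
  ((((2 * j : ℕ) : ℝ) - 1) / K) * P1 (2 * j) (2 * Real.pi * m) * P2 (2 * j - 1) ((2 * Real.pi) ^ 3 * ξ)

lemma P1_zero (y : ℝ) : P1 0 y = 0 := by simp [P1]

lemma gg_zero (K : ℝ) (m : ℕ) (ξ : ℝ) : gg K m ξ 0 = 0 := by
  unfold gg
  rw [Nat.mul_zero, P1_zero]; ring

lemma gg_nonneg (K : ℝ) (hK : 2 ≤ K) (m : ℕ) (ξ : ℝ) (hξ : 0 < ξ) (j : ℕ) : 0 ≤ gg K m ξ j := by
  rcases Nat.eq_zero_or_pos j with rfl | hj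
  · rw [gg_zero]
  unfold gg
  have h1 : (1:ℝ) ≤ ((2 * j : ℕ) : ℝ) := by exact_mod_cast (by omega : 1 ≤ 2 * j)
  refine mul_nonneg (mul_nonneg (div_nonneg (by linarith) (by linarith)) (P1_nonneg _ _ (by positivity))) ((P2_nice _).nonneg _ (by positivity))

lemma gg_mono (K : ℝ) (hK : 2 ≤ K) (m : ℕ) (ξ : ℝ) (hξ : 0 < ξ) : Monotone (gg K m ξ) := by
  refine monotone_nat_of_le_succ fun j => ?_
  rcases Nat.eq_zero_or_pos j with rfl | hj
  · rw [gg_zero]; exact gg_nonneg K hK m ξ hξ _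
  unfold gg
  have h1 : (1:ℝ) ≤ ((2 * j : ℕ) : ℝ) := by exact_mod_cast (by omega : 1 ≤ 2 * j)
  have h2 : ((2 * j : ℕ) : ℝ) ≤ ((2 * (j+1) : ℕ) : ℝ) := by exact_mod_cast (by omega)
  have hy : 0 < (2 * Real.pi) ^ 3 * ξ := by positivity
  have hy2 : 0 ≤ 2 * Real.pi * (m : ℝ) := by positivity
  refine mul_le_mul (mul_le_mul ?_ ?_ (P1_nonneg _ _ hy2) ?_) ?_ ((P2_nice _).nonneg _ hy) ?_
  · exact div_le_div_of_nonneg_right (by linarith) (by linarith)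
  · exact P1_mono _ hy2 (by omega)
  · exact div_nonneg (by linarith) (by linarith)
  · exact P2_mono _ hy (by omega)
  · exact mul_nonneg (div_nonneg (by linarith) (by linarith)) (P1_nonneg _ _ hy2)

lemma gg_top (K : ℝ) (hK : 2 ≤ K) (m : ℕ) (hm : 0 < m) (ξ : ℝ) (hξ : 0 < ξ) (J : ℕ) (hJ0 : 1 ≤ J) (hJ : (J : ℝ) ≤ K + 1) :
    gg K m ξ J ≤ 24 * (1 / (1 + (m:ℝ) / K)) ^ 3 * min 1 (K ^ 2 / ξ) := by
  have hpi := Real.pi_gt_three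
  have hK0 : 0 < K := by linarith
  have hm0 : (0:ℝ) < m := by exact_mod_cast hm
  have hJ1 : (1:ℝ) ≤ J := by exact_mod_cast hJ0
  have hy : 0 < (2 * Real.pi) ^ 3 * ξ := by positivity
  have hy2 : 0 < 2 * Real.pi * (m : ℝ) := by positivity
  have e1 : (((2 * J : ℕ) : ℝ) - 1) / K ≤ 3 := by
    rw [div_le_iff₀ hK0]; push_cast; linarith
  have e10 : 0 ≤ (((2 * J : ℕ) : ℝ) - 1) / K := by
    apply div_nonneg _ hK0.le; push_cast; linarith
  have e2 : P1 (2 * J) (2 * Real.pi * m) ≤ 8 * (1 / (1 + (m:ℝ) / K)) ^ 3 := by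
    set t := (m:ℝ) / K with ht
    have ht0 : 0 < t := by positivity
    by_cases h : t ≤ 1
    · refine (P1_le_one _ _ hy2.le).trans ?_
      have : 1 / 2 ≤ 1 / (1 + t) := one_div_le_one_div_of_le (by linarith) (by linarith)
      have := pow_le_pow_left₀ (by norm_num) this 3
      linarith
    · push Not at h
      refine (P1_decay _ _ hy2).trans ?_
      have h1 : (((2 * J : ℕ) : ℝ) + 2) / (2 * Real.pi * m) ≤ 2 * (1 / (1 + t)) := by
        calc (((2 * J : ℕ) : ℝ) + 2) / (2 * Real.pi * m) ≤ (4 * K) / (4 * m) := by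
              apply div_le_div₀ (by positivity) (by push_cast; linarith) (by positivity)
              nlinarith
          _ = 1 / t := by rw [ht]; field_simp
          _ ≤ 2 * (1 / (1 + t)) := by
              rw [mul_one_div, div_le_div_iff₀ ht0 (by linarith)]; linarith
      have := pow_le_pow_left₀ (by positivity) h1 3
      calc _ ≤ _ := this
        _ = _ := by ring
  have e3 : P2 (2 * J - 1) ((2 * Real.pi) ^ 3 * ξ) ≤ min 1 (K ^ 2 / ξ) := by
    refine le_min ((P2_nice _).le_one _ hy) ((P2_decay _ _ hy).trans ?_)
    have hc : (((2 * J - 1 : ℕ) : ℝ)) = 2 * J - 1 := by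
      rw [Nat.cast_sub (by omega)]; push_cast; ring
    rw [hc, div_le_div_iff₀ hy hξ]
    have h216 : 216 ≤ (2 * Real.pi) ^ 3 := by
      have := pow_le_pow_left₀ (by norm_num) (by linarith : (6:ℝ) ≤ 2 * Real.pi) 3
      linarith
    have h2 : ((2 * (J:ℝ) - 1 + 1) * (2 * (2 * J - 1) + 1)) ≤ 216 * K ^ 2 := by
      have : (J:ℝ) ≤ 2 * K := by linarith
      nlinarith
    calc _ ≤ 216 * K ^ 2 * ξ := mul_le_mul_of_nonneg_right h2 hξ.le
      _ = K ^ 2 * (216 * ξ) := by ring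
      _ ≤ _ := by gcongr
  unfold gg
  have e30 := (P2_nice (2 * J - 1)).nonneg _ hy
  have e20 := P1_nonneg (2 * J) _ hy2.le
  calc _ ≤ 3 * (8 * (1 / (1 + (m:ℝ) / K)) ^ 3) * min 1 (K ^ 2 / ξ) := by
        refine mul_le_mul (mul_le_mul e1 e2 e20 (by norm_num)) e3 e30 (by positivity)
    _ = _ := by ring

lemma min_split (z t : ℝ) (hz : 0 ≤ z) (ht : 0 ≤ t) : min 1 (z * t) ≤ (1 + t) * min 1 z := by
  rcases le_total 1 z with h | h
  · rw [min_eq_left h]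
    exact (min_le_left _ _).trans (by linarith)
  · rw [min_eq_right h]
    refine (min_le_right _ _).trans (by nlinarith)

/-- common shape -/
lemma shape (K : ℝ) (hK : 2 ≤ K) (m c : ℕ) (hm : 0 < m) (hc : 0 < c) (B ξ : ℝ) (hB : 0 < B) (hξ : B ≤ ξ)
    (J : ℕ) (hJ0 : 1 ≤ J) (hJ : (J : ℝ) ≤ K + 1) :
    gg K m ξ J * min 1 ((4 * Real.pi * Real.sqrt (B * m) / c / K) ^ 2)
      ≤ 24 * ((1 / (1 + (m:ℝ) / K)) ^ 2 * min 1 (K ^ 2 / B) * min 1 ((16 * Real.pi ^ 2 * B / K) / c ^ 2)) := by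
  have hK0 : 0 < K := by linarith
  have hξ0 : 0 < ξ := by linarith
  have hm0 : (0:ℝ) < m := by exact_mod_cast hm
  have hc0 : (0:ℝ) < c := by exact_mod_cast hc
  have e : (4 * Real.pi * Real.sqrt (B * m) / c / K) ^ 2 = (16 * Real.pi ^ 2 * B / K) / c ^ 2 * (m / K) := by
    rw [div_pow, div_pow, mul_pow, Real.sq_sqrt (by positivity)]
    field_simp
    norm_num
  rw [e]
  set t := (m:ℝ) / K with ht
  have ht0 : 0 < t := by positivity
  have h1 := gg_top K hK m hm ξ hξ0 J hJ0 hJ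
  have h2 := min_split ((16 * Real.pi ^ 2 * B / K) / c ^ 2) t (by positivity) ht0.le
  have h3 : min 1 (K ^ 2 / ξ) ≤ min 1 (K ^ 2 / B) := min_le_min_left _ (by gcongr)
  calc _ ≤ (24 * (1 / (1 + t)) ^ 3 * min 1 (K ^ 2 / ξ)) * ((1 + t) * min 1 ((16 * Real.pi ^ 2 * B / K) / c ^ 2)) :=
        mul_le_mul h1 h2 (by positivity) (by positivity)
    _ ≤ (24 * (1 / (1 + t)) ^ 3 * min 1 (K ^ 2 / B)) * ((1 + t) * min 1 ((16 * Real.pi ^ 2 * B / K) / c ^ 2)) := by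
        gcongr
    _ = _ := by
        have : 1 + t ≠ 0 := by positivity
        field_simp

end

section
open MeasureTheory Set

lemma U_le (K : ℝ) (hK : 0 < K) (δ : ℝ) (hδ : 0 < δ) (hδ1 : δ < 1) (m : ℕ) :
    (1 / (1 + (m:ℝ) / K)) ^ 2 / m ≤ K ^ δ * (1 / (m:ℝ) ^ (1 + δ)) := by
  rcases Nat.eq_zero_or_pos m with rfl | hm
  · simp; rw [Real.zero_rpow (by linarith)]; simp
  have hm0 : (0:ℝ) < m := by exact_mod_cast hm
  set t := (m:ℝ) / K with ht
  have ht0 : 0 < t := by positivity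
  have h1 : (1 / (1 + t)) ^ 2 ≤ (1 / t) ^ δ := by
    calc (1 / (1 + t)) ^ 2 = (1 / (1 + t)) ^ (2:ℝ) := by norm_cast
      _ ≤ (1 / (1 + t)) ^ δ := by
          apply Real.rpow_le_rpow_of_exponent_ge (by positivity) _ (by linarith)
          rw [div_le_one (by positivity)]; linarith
      _ ≤ _ := by
          apply Real.rpow_le_rpow (by positivity) _ hδ.le
          exact one_div_le_one_div_of_le ht0 (by linarith)
  calc _ ≤ (1 / t) ^ δ / m := by gcongr
    _ = _ := by
      rw [ht, one_div_div, Real.div_rpow hK.le hm0.le, Real.rpow_add hm0, Real.rpow_one]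
      field_simp

lemma inner_fin (K : ℝ) (hK : 2 ≤ K) (δ : ℝ) (hδ : 0 < δ) (hδ1 : δ < 1) (n : ℤ) (c : ℕ) (hc : 0 < c) (N : ℕ) :
    ∑ m ∈ Finset.range N, (1 / (1 + (m:ℝ) / K)) ^ 2 * (‖kloos n (m:ℤ) c‖ / Real.sqrt m)
      ≤ (1 + ∑' m : ℕ, 1 / (m:ℝ) ^ (1 + δ)) * K ^ δ * (c + Real.sqrt K * Real.sqrt c) := by
  have hK0 : 0 < K := by linarith
  have hc0 : (0:ℝ) < c := by exact_mod_cast hc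
  set lam := Real.sqrt ((c:ℝ) ^ 2 + K * c) with hl
  have hl0 : 0 < lam := Real.sqrt_pos.mpr (by positivity)
  have hl2 : lam ^ 2 = (c:ℝ) ^ 2 + K * c := Real.sq_sqrt (by positivity)
  have hsum : Summable fun m : ℕ => 1 / (m:ℝ) ^ (1 + δ) := Real.summable_one_div_nat_rpow.mpr (by linarith)
  have hle : lam ≤ c + Real.sqrt K * Real.sqrt c := by
    rw [hl]
    refine Real.sqrt_le_iff.mpr ⟨by positivity, ?_⟩
    have h1 := Real.sq_sqrt hK0.le
    have h2 := Real.sq_sqrt hc0.le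
    have : (Real.sqrt K * Real.sqrt c) ^ 2 = K * c := by rw [mul_pow, h1, h2]
    have : 0 ≤ (c:ℝ) * (Real.sqrt K * Real.sqrt c) := by positivity
    nlinarith
  have hKδ : 1 ≤ K ^ δ := Real.one_le_rpow (by linarith) hδ.le
  have hterm : ∀ m ∈ Finset.range N, (1 / (1 + (m:ℝ) / K)) ^ 2 * (‖kloos n (m:ℤ) c‖ / Real.sqrt m)
      ≤ lam * (K ^ δ * (1 / (m:ℝ) ^ (1 + δ))) + (1 / lam) * ((1 / (1 + (m:ℝ) / K)) ^ 2 * ‖kloos n (m:ℤ) c‖ ^ 2) := by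
    intro m _
    have hU := U_le K hK0 δ hδ hδ1 m
    set U := (1 / (1 + (m:ℝ) / K)) ^ 2
    have hU0 : 0 ≤ U := by positivity
    set S := ‖kloos n (m:ℤ) c‖
    have hS : S / Real.sqrt m ≤ lam * (1 / m) + (1 / lam) * S ^ 2 := by
      have hs : (1 / Real.sqrt m) ^ 2 = 1 / m := by
        rw [div_pow, one_pow, Real.sq_sqrt (Nat.cast_nonneg m)]
      rw [← hs, div_eq_mul_one_div]
      set y := 1 / Real.sqrt m
      have hy : 0 ≤ y := by positivity
      have hSn : 0 ≤ S := norm_nonneg _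
      have h0 : 0 ≤ (1 / lam) * ((S - lam * y) ^ 2) := by positivity
      have h1 : (1 / lam) * ((S - lam * y) ^ 2) = (1 / lam) * S ^ 2 - 2 * S * y + lam * y ^ 2 := by
        field_simp; ring
      nlinarith [mul_nonneg hSn hy]
    calc U * (S / Real.sqrt m) ≤ U * (lam * (1 / m) + (1 / lam) * S ^ 2) := by gcongr
      _ = lam * (U / m) + (1 / lam) * (U * S ^ 2) := by ring
      _ ≤ _ := by gcongr
  refine (Finset.sum_le_sum hterm).trans ?_
  rw [Finset.sum_add_distrib, ← Finset.mul_sum, ← Finset.mul_sum, ← Finset.mul_sum]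
  have h1 := hsum.sum_le_tsum (Finset.range N) (fun i _ => by positivity)
  have h2 := kloos_weighted c hc n K hK0 N
  rw [← hl2] at h2
  set T := ∑' m : ℕ, 1 / (m:ℝ) ^ (1 + δ)
  have hT : 0 ≤ T := tsum_nonneg (fun i => by positivity)
  calc _ ≤ lam * (K ^ δ * T) + (1 / lam) * lam ^ 2 := by gcongr
    _ = (1 + T * K ^ δ) * lam := by field_simp; ring
    _ ≤ ((1 + T) * K ^ δ) * lam := by gcongr; linarith
    _ ≤ _ := by gcongr

lemma min_pow (z p : ℝ) (hz : 0 ≤ z) (hp : 0 ≤ p) (hp2 : p ≤ 2) : min 1 (z ^ 2) ≤ z ^ p := by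
  rcases le_total 1 z with h | h
  · exact (min_le_left _ _).trans (Real.one_le_rpow h hp)
  · rcases hz.eq_or_lt with rfl | hz
    · refine (min_le_right _ _).trans ?_
      simp; positivity
    refine (min_le_right _ _).trans ?_
    calc z ^ 2 = z ^ (2:ℝ) := by norm_cast
      _ ≤ _ := Real.rpow_le_rpow_of_exponent_ge hz h hp2

/-- abstract majorant -/
noncomputable def maj (K : ℝ) (Z : ℝ) (n : ℤ) (p : ℕ × ℕ) : ℝ :=
  (1 / (1 + (p.2:ℝ) / K)) ^ 2 * (‖kloos n (p.2:ℤ) p.1‖ / Real.sqrt p.2) * (min 1 ((Z / p.1) ^ 2) / p.1)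

lemma maj_nonneg (K Z n p) : 0 ≤ maj K Z n p := by unfold maj; positivity

lemma c_term (K Z δ : ℝ) (hK : 2 ≤ K) (hZ : 0 < Z) (hδ : 0 < δ) (hδ1 : δ < 1) (c : ℕ) (hc : 0 < c) :
    (c + Real.sqrt K * Real.sqrt c) * (min 1 ((Z / c) ^ 2) / c)
      ≤ (Z ^ (1 + δ) + Real.sqrt K * Z ^ (1/2 + δ)) * (1 / (c:ℝ) ^ (1 + δ)) := by
  have hc0 : (0:ℝ) < c := by exact_mod_cast hc
  have h1 := min_pow (Z / c) (1 + δ) (by positivity) (by linarith) (by linarith)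
  have h2 := min_pow (Z / c) (1/2 + δ) (by positivity) (by linarith) (by linarith)
  rw [Real.div_rpow hZ.le hc0.le] at h1 h2
  set mm := min 1 ((Z / c) ^ 2)
  have hs : Real.sqrt c = (c:ℝ) ^ (1/2:ℝ) := Real.sqrt_eq_rpow _
  have e : (c:ℝ) ^ (1/2:ℝ) * (1 / (c:ℝ) ^ (1/2 + δ) / c) = 1 / (c:ℝ) ^ (1 + δ) := by
    have : (c:ℝ) ^ (1 + δ) = c * (c:ℝ) ^ δ := by rw [Real.rpow_add hc0, Real.rpow_one]
    rw [this, Real.rpow_add hc0]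
    field_simp
  calc _ = mm * (c / c) + Real.sqrt K * (Real.sqrt c * (mm / c)) := by ring
    _ = mm + Real.sqrt K * (Real.sqrt c * (mm / c)) := by rw [div_self hc0.ne', mul_one]
    _ ≤ Z ^ (1 + δ) / (c:ℝ) ^ (1 + δ) + Real.sqrt K * (Real.sqrt c * (Z ^ (1/2 + δ) / (c:ℝ) ^ (1/2 + δ) / c)) := by
        gcongr
    _ = Z ^ (1 + δ) / (c:ℝ) ^ (1 + δ) + Real.sqrt K * Z ^ (1/2 + δ) * ((c:ℝ) ^ (1/2:ℝ) * (1 / (c:ℝ) ^ (1/2 + δ) / c)) := by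
        rw [hs]; ring
    _ = _ := by rw [e]; ring

lemma maj_sum (δ : ℝ) (hδ : 0 < δ) (hδ1 : δ < 1) : ∃ C : ℝ, 0 ≤ C ∧ ∀ (K Z : ℝ) (n : ℤ), 2 ≤ K → 0 < Z →
    Summable (maj K Z n) ∧ ∑' p, maj K Z n p ≤ C * K ^ δ * (Z ^ (1 + δ) + Real.sqrt K * Z ^ (1/2 + δ)) := by
  have hsum : Summable fun m : ℕ => 1 / (m:ℝ) ^ (1 + δ) := Real.summable_one_div_nat_rpow.mpr (by linarith)
  set T := ∑' m : ℕ, 1 / (m:ℝ) ^ (1 + δ) with hTd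
  have hT : 0 ≤ T := tsum_nonneg (fun i => by positivity)
  refine ⟨(1 + T) * T, by positivity, fun K Z n hK hZ => ?_⟩
  have hK0 : 0 < K := by linarith
  have hfin : ∀ c N : ℕ, ∑ m ∈ Finset.range N, maj K Z n (c, m) ≤
      (1 + T) * K ^ δ * (Z ^ (1 + δ) + Real.sqrt K * Z ^ (1/2 + δ)) * (1 / (c:ℝ) ^ (1 + δ)) := by
    intro c N
    rcases Nat.eq_zero_or_pos c with rfl | hc
    · have : ∀ m, maj K Z n (0, m) = 0 := by intro m; simp [maj]
      simp only [this, Finset.sum_const_zero]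
      positivity
    unfold maj
    simp only
    rw [← Finset.sum_mul]
    calc _ ≤ ((1 + T) * K ^ δ * (c + Real.sqrt K * Real.sqrt c)) * (min 1 ((Z / c) ^ 2) / c) := by
          gcongr
          exact inner_fin K hK δ hδ hδ1 n c hc N
      _ = ((1 + T) * K ^ δ) * ((c + Real.sqrt K * Real.sqrt c) * (min 1 ((Z / c) ^ 2) / c)) := by ring
      _ ≤ ((1 + T) * K ^ δ) * ((Z ^ (1 + δ) + Real.sqrt K * Z ^ (1/2 + δ)) * (1 / (c:ℝ) ^ (1 + δ))) := by
          exact mul_le_mul_of_nonneg_left (c_term K Z δ hK hZ hδ hδ1 c hc) (by positivity)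
      _ = _ := by ring
  have hs1 : ∀ c, Summable fun m => maj K Z n (c, m) := fun c =>
    summable_of_sum_range_le (fun m => maj_nonneg _ _ _ _) (hfin c)
  have ht1 : ∀ c, ∑' m, maj K Z n (c, m) ≤ (1 + T) * K ^ δ * (Z ^ (1 + δ) + Real.sqrt K * Z ^ (1/2 + δ)) * (1 / (c:ℝ) ^ (1 + δ)) := fun c =>
    Real.tsum_le_of_sum_range_le (fun m => maj_nonneg _ _ _ _) (hfin c)
  have hs2 : Summable fun c => ∑' m, maj K Z n (c, m) :=
    Summable.of_nonneg_of_le (fun c => tsum_nonneg fun m => maj_nonneg _ _ _ _) ht1 (hsum.mul_left _)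
  have hs : Summable (maj K Z n) := (summable_prod_of_nonneg (fun p => maj_nonneg _ _ _ _)).mpr ⟨hs1, hs2⟩
  refine ⟨hs, ?_⟩
  rw [hs.tsum_prod' hs1]
  refine (hs2.tsum_le_tsum ht1 (hsum.mul_left _)).trans ?_
  rw [tsum_mul_left, ← hTd]
  apply le_of_eq; ring

end

section
open MeasureTheory Set

noncomputable def FF (w : ℝ → ℝ) (K : ℝ) (n : ℤ) (r : ℕ) (B ξ : ℝ) (j : ℕ) (p : ℕ × ℕ) : ℂ :=
  kloos n (p.2:ℤ) p.1 / ((Real.sqrt ((p.2:ℝ) * r) * p.1 : ℝ) : ℂ) *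
    (((w (((2 * j : ℕ) : ℝ) / K) * gg K p.2 ξ j : ℝ) : ℂ) * besselJ (2 * (2 * j) - 1) (4 * Real.pi * Real.sqrt (B * p.2) / p.1))

noncomputable def ZZ (K B : ℝ) : ℝ := 4 * Real.pi * Real.sqrt B / Real.sqrt K

lemma FF_shape (K : ℝ) (hK : 2 ≤ K) (n : ℤ) (r : ℕ) (hr : 0 < r) (B ξ : ℝ) (hB : 0 < B) (hξ : B ≤ ξ)
    (J : ℕ) (hJ0 : 1 ≤ J) (hJ : (J : ℝ) ≤ K + 1) (p : ℕ × ℕ) (X : ℂ) (D : ℝ) (hD : 0 ≤ D)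
    (hX : 0 < p.1 → 0 < p.2 → ‖X‖ ≤ D * (gg K p.2 ξ J * min 1 ((4 * Real.pi * Real.sqrt (B * p.2) / p.1 / K) ^ 2))) :
    ‖kloos n (p.2:ℤ) p.1 / ((Real.sqrt ((p.2:ℝ) * r) * p.1 : ℝ) : ℂ) * X‖ ≤ 24 * D * min 1 (K ^ 2 / B) * maj K (ZZ K B) n p := by
  obtain ⟨c, m⟩ := p
  simp only at hX ⊢
  have hK0 : 0 < K := by linarith
  have hR : 0 ≤ 24 * D * min 1 (K ^ 2 / B) * maj K (ZZ K B) n (c, m) := by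
    have := maj_nonneg K (ZZ K B) n (c, m)
    positivity
  rcases Nat.eq_zero_or_pos c with rfl | hc
  · simpa using hR
  rcases Nat.eq_zero_or_pos m with rfl | hm
  · simpa using hR
  have hm0 : (0:ℝ) < m := by exact_mod_cast hm
  have hc0 : (0:ℝ) < c := by exact_mod_cast hc
  have hr1 : (1:ℝ) ≤ r := by exact_mod_cast hr
  have h1 := hX hc hm
  have h2 := shape K hK m c hm hc B ξ hB hξ J hJ0 hJ
  have hZ : (ZZ K B / c) ^ 2 = (16 * Real.pi ^ 2 * B / K) / c ^ 2 := by
    unfold ZZ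
    rw [div_pow, div_pow, mul_pow, Real.sq_sqrt hB.le, Real.sq_sqrt hK0.le]; ring
  rw [← hZ] at h2
  have h3 : ‖kloos n (m:ℤ) c / ((Real.sqrt ((m:ℝ) * r) * c : ℝ) : ℂ)‖ ≤ ‖kloos n (m:ℤ) c‖ / Real.sqrt m / c := by
    rw [norm_div, Complex.norm_real, Real.norm_eq_abs, abs_of_nonneg (by positivity), div_div]
    gcongr
    nlinarith
  rw [norm_mul]
  calc _ ≤ (‖kloos n (m:ℤ) c‖ / Real.sqrt m / c) * (D * (24 * ((1 / (1 + (m:ℝ) / K)) ^ 2 * min 1 (K ^ 2 / B) * min 1 ((ZZ K B / c) ^ 2)))) := by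
        refine mul_le_mul h3 (h1.trans ?_) (norm_nonneg _) (by positivity)
        gcongr
    _ = _ := by unfold maj; simp only; ring

lemma Qpow (K B p : ℝ) (hK : 2 ≤ K) (hB : 0 < B) (hp : 0 ≤ p) (hp2 : p ≤ 2) :
    min 1 (K ^ 2 / B) * ZZ K B ^ p ≤ (4 * Real.pi) ^ 2 * K ^ (p / 2) := by
  have hK0 : 0 < K := by linarith
  have hpi := Real.pi_gt_three
  have hsB : 0 < Real.sqrt B := Real.sqrt_pos.mpr hB
  have hsK : 0 < Real.sqrt K := Real.sqrt_pos.mpr hK0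
  have h1 := min_pow (K / Real.sqrt B) p (by positivity) hp hp2
  rw [div_pow, Real.sq_sqrt hB.le] at h1
  have hZ : 0 < ZZ K B := by unfold ZZ; positivity
  calc _ ≤ (K / Real.sqrt B) ^ p * ZZ K B ^ p := by gcongr
    _ = ((K / Real.sqrt B) * ZZ K B) ^ p := (Real.mul_rpow (by positivity) hZ.le).symm
    _ = (4 * Real.pi * Real.sqrt K) ^ p := by
        congr 1
        unfold ZZ
        have : K = Real.sqrt K * Real.sqrt K := (Real.mul_self_sqrt hK0.le).symm
        field_simp
        rw [sq]
        exact this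
    _ = (4 * Real.pi) ^ p * K ^ (p / 2) := by
        rw [Real.mul_rpow (by positivity) hsK.le, Real.sqrt_eq_rpow, ← Real.rpow_mul hK0.le]
        congr 2; ring
    _ ≤ (4 * Real.pi) ^ (2:ℝ) * K ^ (p / 2) := by
        gcongr
        linarith
    _ = _ := by norm_cast

lemma numeric (K B δ ε : ℝ) (hK : 2 ≤ K) (hB : 0 < B) (hδ : 0 < δ) (hδ1 : δ < 1) (hε : 4 * δ ≤ ε) :
    (1 / (2 * Real.pi ^ 2 * K)) * (K ^ δ * min 1 (K ^ 2 / B) * (K ^ δ * (ZZ K B ^ (1 + δ) + Real.sqrt K * ZZ K B ^ (1/2 + δ))))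
      ≤ 16 * K ^ (-(1/4:ℝ) + ε) := by
  have hK0 : 0 < K := by linarith
  have hpi := Real.pi_pos
  have h1 := Qpow K B (1 + δ) hK hB (by linarith) (by linarith)
  have h2 := Qpow K B (1/2 + δ) hK hB (by linarith) (by linarith)
  set Q := min 1 (K ^ 2 / B)
  have e1 : K ^ δ * K ^ δ * (1 / K) * K ^ ((1 + δ) / 2) = K ^ (δ + δ + (-1) + (1 + δ) / 2) := by
    rw [Real.rpow_add hK0, Real.rpow_add hK0, Real.rpow_add hK0, Real.rpow_neg_one, one_div]
  have e2 : K ^ δ * K ^ δ * (1 / K) * (Real.sqrt K * K ^ ((1/2 + δ) / 2)) = K ^ (δ + δ + (-1) + (1/2 + (1/2 + δ) / 2)) := by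
    rw [Real.rpow_add hK0, Real.rpow_add hK0, Real.rpow_add hK0, Real.rpow_neg_one, one_div, Real.rpow_add hK0, Real.sqrt_eq_rpow]
  have l1 : K ^ (δ + δ + (-1) + (1 + δ) / 2) ≤ K ^ (-(1/4:ℝ) + ε) :=
    Real.rpow_le_rpow_of_exponent_le (by linarith) (by linarith)
  have l2 : K ^ (δ + δ + (-1) + (1/2 + (1/2 + δ) / 2)) ≤ K ^ (-(1/4:ℝ) + ε) :=
    Real.rpow_le_rpow_of_exponent_le (by linarith) (by linarith)
  calc _ = (1 / (2 * Real.pi ^ 2)) * (K ^ δ * K ^ δ * (1 / K)) * (Q * ZZ K B ^ (1 + δ) + Real.sqrt K * (Q * ZZ K B ^ (1/2 + δ))) := by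
        field_simp
    _ ≤ (1 / (2 * Real.pi ^ 2)) * (K ^ δ * K ^ δ * (1 / K)) * ((4 * Real.pi) ^ 2 * K ^ ((1 + δ) / 2) + Real.sqrt K * ((4 * Real.pi) ^ 2 * K ^ ((1/2 + δ) / 2))) := by
        gcongr
    _ = (1 / (2 * Real.pi ^ 2)) * (4 * Real.pi) ^ 2 * (K ^ δ * K ^ δ * (1 / K) * K ^ ((1 + δ) / 2) + K ^ δ * K ^ δ * (1 / K) * (Real.sqrt K * K ^ ((1/2 + δ) / 2))) := by ring
    _ = 8 * (K ^ (δ + δ + (-1) + (1 + δ) / 2) + K ^ (δ + δ + (-1) + (1/2 + (1/2 + δ) / 2))) := by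
        rw [e1, e2]; congr 1; field_simp; norm_num
    _ ≤ _ := by linarith

lemma lip (w : ℝ → ℝ) (hsm : ContDiff ℝ (⊤ : ℕ∞) w) (M : ℝ) (h : ∀ u, |iteratedDeriv 1 w u| ≤ M) (u v : ℝ) :
    |w u - w v| ≤ M * |u - v| := by
  have := Convex.norm_image_sub_le_of_norm_deriv_le (f := w) (C := M) (s := Set.univ) (x := v) (y := u)
    (fun x _ => (hsm.differentiable (by simp)).differentiableAt)
    (fun x _ => by have := h x; rwa [iteratedDeriv_one] at this) convex_univ trivial trivial
  simpa using this

end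

section
open MeasureTheory Set

lemma k_term (w : ℝ → ℝ) (hsupp : Function.support w ⊆ Set.Ioo 1 2) (K : ℝ) (hK : 2 ≤ K)
    (α β γ r₁ r₂ : ℕ) (hα : 0 < α) (hβ : 0 < β) (hγ : 0 < γ) (hr₁ : 0 < r₁) (hr₂ : 0 < r₂) (j : ℕ)
    (hs : Summable (FF w K ((r₁ : ℤ) * α * β ^ 2) r₁ ((r₁:ℝ) * α * β ^ 2) ((r₁ : ℝ) * r₂ ^ 2 * α ^ 3 * β ^ 2 * γ ^ 2) j)) :
    (if Even (2 * j) ∧ 2 ≤ 2 * j then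
          ((w (((2 * j : ℕ) : ℝ) / K) * ((((2 * j : ℕ) : ℝ) - 1) / K) : ℝ) : ℂ) *
          ∑' m : ℕ, ∑' c₁ : ℕ, (if 1 ≤ m ∧ 1 ≤ c₁ then
            kloos ((r₁ : ℤ) * α * β ^ 2) (m : ℤ) c₁
              / ((Real.sqrt ((m : ℝ) * r₁) * c₁ : ℝ) : ℂ) *
            besselJ (2 * (2 * j) - 1) (4 * Real.pi * Real.sqrt ((r₁ : ℝ) * m * α * β ^ 2) / c₁) *
            V 1 ((2 * j : ℕ) : ℝ) (m : ℝ) *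
            V 2 ((2 * j : ℕ) : ℝ) ((r₁ : ℝ) * r₂ ^ 2 * α ^ 3 * β ^ 2 * γ ^ 2)
          else 0)
        else 0)
      = ∑' p, FF w K ((r₁ : ℤ) * α * β ^ 2) r₁ ((r₁:ℝ) * α * β ^ 2) ((r₁ : ℝ) * r₂ ^ 2 * α ^ 3 * β ^ 2 * γ ^ 2) j p := by
  by_cases hw : w (((2 * j : ℕ) : ℝ) / K) = 0
  · have : ∀ p, FF w K ((r₁ : ℤ) * α * β ^ 2) r₁ ((r₁:ℝ) * α * β ^ 2) ((r₁ : ℝ) * r₂ ^ 2 * α ^ 3 * β ^ 2 * γ ^ 2) j p = 0 := by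
      intro p; unfold FF; rw [hw]; simp
    simp only [this, tsum_zero]
    rw [hw]; simp
  have hj : 0 < j := by
    rcases Nat.eq_zero_or_pos j with rfl | h
    · exact absurd (a_zero hsupp (by norm_num)) hw
    · exact h
  rw [if_pos ⟨even_two_mul j, by omega⟩]
  have hs' := (Equiv.prodComm ℕ ℕ).summable_iff.mpr hs
  rw [← (Equiv.prodComm ℕ ℕ).tsum_eq]
  simp only [Function.comp_def] at hs'
  rw [Summable.tsum_prod hs', ← tsum_mul_left]
  refine tsum_congr fun m => ?_
  rw [← tsum_mul_left]
  refine tsum_congr fun c => ?_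
  simp only [Equiv.prodComm_apply, Prod.swap_prod_mk]
  by_cases h : 1 ≤ m ∧ 1 ≤ c
  · rw [if_pos h]
    have hm0 : (0:ℝ) < m := by exact_mod_cast h.1
    have h1 := V1_eq (2 * j) (by omega) m hm0
    have hξ : (0:ℝ) < (r₁ : ℝ) * r₂ ^ 2 * α ^ 3 * β ^ 2 * γ ^ 2 := by positivity
    have h2 := V2_eq (2 * j - 1) _ hξ
    rw [show 2 * j - 1 + 1 = 2 * j by omega] at h2
    rw [h1, h2]
    unfold FF gg
    simp only
    rw [show (r₁ : ℝ) * m * α * β ^ 2 = (r₁:ℝ) * α * β ^ 2 * m by ring]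
    push_cast
    ring
  · rw [if_neg h, mul_zero]
    unfold FF
    simp only
    rcases Nat.eq_zero_or_pos m with rfl | hm
    · simp
    rcases Nat.eq_zero_or_pos c with rfl | hc
    · simp
    exact absurd ⟨hm, hc⟩ h

end

theorem stmt5 (ε : ℝ) (hε : 0 < ε) (w : ℝ → ℝ)
    (hsm : ContDiff ℝ (⊤ : ℕ∞) w) (hnn : ∀ u, 0 ≤ w u)
    (hsupp : Function.support w ⊆ Set.Ioo 1 2)
    (hbd : ∀ B : ℕ, ∃ M : ℝ, ∀ u, |iteratedDeriv B w u| ≤ M) :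
    ∃ C : ℝ, ∀ K : ℝ, 2 ≤ K → ∀ α β γ r₁ r₂ : ℕ,
      0 < α → 0 < β → 0 < γ → 0 < r₁ → 0 < r₂ →
      K ^ (-ε) < (r₁ : ℝ) / r₂ → (r₁ : ℝ) / r₂ < K ^ ε →
      ‖((1 / (2 * Real.pi ^ 2 * K) : ℝ) : ℂ) *
        ∑' k : ℕ, if Even k ∧ 2 ≤ k then
          ((w ((k : ℝ) / K) * (((k : ℝ) - 1) / K) : ℝ) : ℂ) *
          ∑' m : ℕ, ∑' c₁ : ℕ, (if 1 ≤ m ∧ 1 ≤ c₁ then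
            kloos ((r₁ : ℤ) * α * β ^ 2) (m : ℤ) c₁
              / ((Real.sqrt ((m : ℝ) * r₁) * c₁ : ℝ) : ℂ) *
            besselJ (2 * k - 1) (4 * Real.pi * Real.sqrt ((r₁ : ℝ) * m * α * β ^ 2) / c₁) *
            V 1 (k : ℝ) (m : ℝ) *
            V 2 (k : ℝ) ((r₁ : ℝ) * r₂ ^ 2 * α ^ 3 * β ^ 2 * γ ^ 2)
          else 0)
        else 0‖ ≤ C * K ^ (-(1/4 : ℝ) + ε) := by
  obtain ⟨M, hM⟩ := hbd 0
  simp only [iteratedDeriv_zero] at hM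
  obtain ⟨L, hL⟩ := hbd 1
  have hM0 : 0 ≤ M := (abs_nonneg _).trans (hM 0)
  have hL0 : 0 ≤ L := (abs_nonneg _).trans (hL 0)
  have hlip := lip w hsm L hL
  obtain ⟨δ, hδ, hδ1, hδε⟩ : ∃ δ : ℝ, 0 < δ ∧ δ < 1 ∧ 4 * δ ≤ ε := by
    refine ⟨min ε 1 / 4, ?_, ?_, ?_⟩
    · have : 0 < min ε 1 := lt_min hε one_pos
      linarith
    · have := min_le_right ε 1
      linarith
    · have := min_le_left ε 1
      linarith
  obtain ⟨C, hC, hmaj⟩ := maj_sum δ hδ hδ1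
  set A := (16 / δ + 16) * (M + 4 * L) with hA
  have hA0 : 0 ≤ A := by positivity
  refine ⟨24 * A * C * 16, fun K hK α β γ r₁ r₂ hα hβ hγ hr₁ hr₂ _ _ => ?_⟩
  have hK0 : 0 < K := by linarith
  set J := ⌊K⌋₊ + 1 with hJ
  have hJ1 : K < J := by rw [hJ]; push_cast; exact Nat.lt_floor_add_one K
  have hJ2 : (J:ℝ) ≤ K + 1 := by
    rw [hJ]; push_cast; linarith [Nat.floor_le hK0.le]
  have hJ3 : (J:ℝ) ≤ 2 * K := by linarith
  have hJ0 : 1 ≤ J := by omega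
  set B : ℝ := (r₁:ℝ) * α * β ^ 2 with hB
  set ξ : ℝ := (r₁ : ℝ) * r₂ ^ 2 * α ^ 3 * β ^ 2 * γ ^ 2 with hξ
  set n : ℤ := (r₁ : ℤ) * α * β ^ 2 with hn
  have hB0 : 0 < B := by positivity
  have hξ0 : 0 < ξ := by positivity
  have hBξ : B ≤ ξ := by
    have h1 : (1:ℝ) ≤ r₂ ^ 2 := one_le_pow₀ (by exact_mod_cast hr₂)
    have h2 : (1:ℝ) ≤ α ^ 2 := one_le_pow₀ (by exact_mod_cast hα)
    have h3 : (1:ℝ) ≤ γ ^ 2 := one_le_pow₀ (by exact_mod_cast hγ)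
    have h4 : (1:ℝ) ≤ r₂ ^ 2 * α ^ 2 * γ ^ 2 := one_le_mul_of_one_le_of_one_le (one_le_mul_of_one_le_of_one_le h1 h2) h3
    calc B = B * 1 := by ring
      _ ≤ B * (r₂ ^ 2 * α ^ 2 * γ ^ 2) := by gcongr
      _ = ξ := by rw [hB, hξ]; ring
  have hZ : 0 < ZZ K B := by
    have := Real.pi_pos
    have := Real.sqrt_pos.mpr hB0
    have := Real.sqrt_pos.mpr hK0
    unfold ZZ; positivity
  obtain ⟨hms, hmt⟩ := hmaj K (ZZ K B) n hK hZ
  have hx0 : ∀ p : ℕ × ℕ, 0 ≤ 4 * Real.pi * Real.sqrt (B * p.2) / p.1 := fun p => by positivity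
  have hsF : ∀ j ∈ Finset.range J, Summable (FF w K n r₁ B ξ j) := by
    intro j hj
    refine Summable.of_norm_bounded (hms.mul_left (24 * (4 * M) * min 1 (K ^ 2 / B))) fun p => ?_
    refine FF_shape K hK n r₁ hr₁ B ξ hB0 hBξ J hJ0 hJ2 p _ (4 * M) (by positivity) fun _ _ => ?_
    refine le_of_le_of_eq ?_ (mul_assoc _ _ _)
    exact term_bd w M hsupp hM K hK (gg K p.2 ξ) (gg_mono K hK p.2 ξ hξ0) (gg_nonneg K hK p.2 ξ hξ0) J _ (hx0 p) j
      (Finset.mem_range.mp hj).le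
  have hpt : ∀ p, ‖∑ j ∈ Finset.range J, FF w K n r₁ B ξ j p‖ ≤ 24 * (A * K ^ δ) * min 1 (K ^ 2 / B) * maj K (ZZ K B) n p := by
    intro p
    unfold FF
    rw [← Finset.mul_sum]
    refine FF_shape K hK n r₁ hr₁ B ξ hB0 hBξ J hJ0 hJ2 p _ (A * K ^ δ) (by positivity) fun _ _ => ?_
    refine (sum_bd w M L hsupp hM hlip hL0 K hK (gg K p.2 ξ) (gg_mono K hK p.2 ξ hξ0) (gg_nonneg K hK p.2 ξ hξ0) J hJ1 hJ3
      _ (hx0 p) δ hδ hδ1).trans (le_of_eq ?_)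
    rw [hA]; ring
  have hinj : Function.Injective (fun j : ℕ => 2 * j) := fun a b h => by simpa using h
  rw [tsum_eq_sum (s := (Finset.range J).image (fun j => 2 * j)), Finset.sum_image (fun a _ b _ h => hinj h)]
  · rw [Finset.sum_congr rfl (fun j hj => k_term w hsupp K hK α β γ r₁ r₂ hα hβ hγ hr₁ hr₂ j (hsF j hj)),
      ← Summable.tsum_finsetSum hsF, norm_mul, Complex.norm_real, Real.norm_eq_abs,
      abs_of_nonneg (by positivity)]
    have hnb := tsum_of_norm_bounded (hms.mul_left (24 * (A * K ^ δ) * min 1 (K ^ 2 / B))).hasSum hpt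
    rw [tsum_mul_left] at hnb
    have hnum := numeric K B δ ε hK hB0 hδ hδ1 hδε
    calc _ ≤ (1 / (2 * Real.pi ^ 2 * K)) * (24 * (A * K ^ δ) * min 1 (K ^ 2 / B) *
            (C * K ^ δ * (ZZ K B ^ (1 + δ) + Real.sqrt K * ZZ K B ^ (1/2 + δ)))) := by
          refine mul_le_mul_of_nonneg_left (hnb.trans ?_) (by positivity)
          exact mul_le_mul_of_nonneg_left hmt (by positivity)
      _ = 24 * A * C * ((1 / (2 * Real.pi ^ 2 * K)) * (K ^ δ * min 1 (K ^ 2 / B) * (K ^ δ * (ZZ K B ^ (1 + δ) + Real.sqrt K * ZZ K B ^ (1/2 + δ))))) := by ring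
      _ ≤ 24 * A * C * (16 * K ^ (-(1/4:ℝ) + ε)) := mul_le_mul_of_nonneg_left hnum (by positivity)
      _ = _ := by ring
  · intro k hk
    split_ifs with h
    · obtain ⟨j, hj⟩ := even_iff_two_dvd.mp h.1
      subst hj
      have hjJ : J ≤ j := by
        by_contra hc
        exact hk (Finset.mem_image.mpr ⟨j, Finset.mem_range.mpr (by omega), rfl⟩)
      have hjJ' : (J:ℝ) ≤ j := by exact_mod_cast hjJ
      have : w (((2 * j : ℕ) : ℝ) / K) = 0 := a_zero hsupp (by
        rintro ⟨-, h⟩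
        rw [div_lt_iff₀ hK0] at h
        push_cast at h
        linarith)
      rw [this]; simp
    · rfl
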